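/- Let A be any C*-algebra with stable rank one and let X be a compact metric space of covering dimension one. Then the stable rank of C(X,A) equals 1 if A has no K₁-obstructions, and equals 2 otherwise. -/

import Mathlib

noncomputable section

set_option maxHeartbeats 1000000

def StableRankOne (A : Type*) [NonUnitalCStarAlgebra A] : Prop :=
  Dense {x : Unitization ℂ A | IsUnit x}

def K1Trivial (B : Type*) [NonUnitalCStarAlgebra B] : Prop :=
  ∀ n : ℕ, 0 < n → ∀ u : unitary (Matrix (Fin n) (Fin n) (Unitization ℂ B)),
    ∃ (k : ℕ) (h : Matrix.fromBlocks u.1 0 0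
        (1 : Matrix (Fin k) (Fin k) (Unitization ℂ B)) ∈
        unitary (Matrix (Fin n ⊕ Fin k) (Fin n ⊕ Fin k) (Unitization ℂ B))),
      Joined (1 : unitary (Matrix (Fin n ⊕ Fin k) (Fin n ⊕ Fin k) (Unitization ℂ B)))
        ⟨Matrix.fromBlocks u.1 0 0 1, h⟩

def NoK1Obstructions (A : Type*) [NonUnitalCStarAlgebra A] : Prop :=
  StableRankOne A ∧
    ∀ (B : NonUnitalStarSubalgebra ℂ A) [IsClosed (B : Set A)],
      (∀ b ∈ B, ∀ a : A, ∀ b' ∈ B, b * a * b' ∈ B) → K1Trivial B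
/-- Covering dimension at most `n`: every finite open cover has a finite open refinement
covering `X` in which each point lies in at most `n + 1` members. -/
def CoveringDimLE (X : Type*) [TopologicalSpace X] (n : ℕ) : Prop :=
  ∀ 𝒰 : Finset (Set X), (∀ U ∈ 𝒰, IsOpen U) → ⋃₀ (𝒰 : Set (Set X)) = Set.univ →
    ∃ 𝒱 : Finset (Set X), (∀ V ∈ 𝒱, IsOpen V) ∧ ⋃₀ (𝒱 : Set (Set X)) = Set.univ ∧
      (∀ V ∈ 𝒱, ∃ U ∈ 𝒰, V ⊆ U) ∧
      ∀ x : X, Set.ncard {V : Set X | V ∈ 𝒱 ∧ x ∈ V} ≤ n + 1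

/-- Covering dimension exactly `n`. -/
def CoveringDimEq (X : Type*) [TopologicalSpace X] (n : ℕ) : Prop :=
  CoveringDimLE X n ∧ ∀ m : ℕ, CoveringDimLE X m → n ≤ m

/-- `sr(A) ≤ n`: the left-invertible `n`-tuples over the minimal unitization are dense. -/
def StableRankLE (A : Type*) [NonUnitalCStarAlgebra A] (n : ℕ) : Prop :=
  Dense {a : Fin n → Unitization ℂ A | ∃ b : Fin n → Unitization ℂ A, ∑ i, b i * a i = 1}

/-- The stable rank of a C*-algebra: the least `n ≥ 1` with `sr(A) ≤ n`. -/
def stableRank (A : Type*) [NonUnitalCStarAlgebra A] : ℕ :=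
  sInf {n : ℕ | 0 < n ∧ StableRankLE A n}

open Matrix in
theorem Matrix.dense_isUnit_sum_unit {R ι : Type*} [Ring R] [TopologicalSpace R]
    [IsTopologicalRing R] [Fintype ι] [DecidableEq ι] (hR : Dense {x : R | IsUnit x})
    (hι : Dense {M : Matrix ι ι R | IsUnit M}) :
    Dense {M : Matrix (ι ⊕ Unit) (ι ⊕ Unit) R | IsUnit M} := by
  have key : ∀ (P : Matrix ι ι R) (q : Matrix ι Unit R) (r : Matrix Unit ι R) (d : Rˣ),
      fromBlocks P q r (of fun _ _ => (d : R)) ∈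
        closure {M : Matrix (ι ⊕ Unit) (ι ⊕ Unit) R | IsUnit M} := by
    intro P q r d
    set D : Matrix Unit Unit R := of fun _ _ => (d : R) with hD
    set D' : Matrix Unit Unit R := of fun _ _ => ((d⁻¹ : Rˣ) : R) with hD'
    have h1 : D * D' = 1 := by ext i j; simp [D, D', mul_apply]
    have h2 : D' * D = 1 := by ext i j; simp [D, D', mul_apply]
    set F : Matrix ι ι R → Matrix (ι ⊕ Unit) (ι ⊕ Unit) R := fun Q =>
      fromBlocks 1 (q * D') 0 1 * fromBlocks Q 0 0 D * fromBlocks 1 0 (D' * r) 1 with hF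
    have hFc : Continuous F := by
      have : Continuous fun Q : Matrix ι ι R =>
          (fromBlocks Q 0 0 D : Matrix (ι ⊕ Unit) (ι ⊕ Unit) R) := by
        fun_prop
      fun_prop
    have hFe : F (P - q * D' * r) = fromBlocks P q r D := by
      simp only [F, fromBlocks_multiply]
      congr 1
      · simp [Matrix.mul_assoc, ← Matrix.mul_assoc D D', h1]
      · simp [Matrix.mul_assoc, h2]
      · simp [← Matrix.mul_assoc, h1]
      · simp
    rw [← hFe]
    refine map_mem_closure hFc (hι (P - q * D' * r)) fun Q hQ => ?_
    obtain ⟨Q, rfl⟩ := hQ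
    refine ((IsUnit.mul ?_ ?_).mul ?_)
    · refine ⟨⟨fromBlocks 1 (q * D') 0 1, fromBlocks 1 (-(q * D')) 0 1, ?_, ?_⟩, rfl⟩ <;>
        simp [fromBlocks_multiply]
    · refine ⟨⟨fromBlocks Q 0 0 D, fromBlocks (Q⁻¹ : (Matrix ι ι R)ˣ) 0 0 D', ?_, ?_⟩, rfl⟩ <;>
        simp [fromBlocks_multiply, h1, h2]
    · refine ⟨⟨fromBlocks 1 0 (D' * r) 1, fromBlocks 1 0 (-(D' * r)) 1, ?_, ?_⟩, rfl⟩ <;>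
        simp [fromBlocks_multiply]
  intro M
  set G : R → Matrix (ι ⊕ Unit) (ι ⊕ Unit) R := fun d =>
    fromBlocks M.toBlocks₁₁ M.toBlocks₁₂ M.toBlocks₂₁ (of fun _ _ => d) with hG
  have hGc : Continuous G := by
    have : Continuous fun d : R => (of fun _ _ => d : Matrix Unit Unit R) := by
      refine continuous_matrix fun i j => ?_
      exact continuous_id
    fun_prop
  have hGe : G (M (Sum.inr ()) (Sum.inr ())) = M := by
    rw [← fromBlocks_toBlocks M]
    simp only [G]
    congr 1
  rw [← hGe]
  have := map_mem_closure (t := closure {M : Matrix (ι ⊕ Unit) (ι ⊕ Unit) R | IsUnit M}) hGc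
    (hR (M (Sum.inr ()) (Sum.inr ()))) fun d hd => ?_
  · rwa [closure_closure] at this
  · obtain ⟨d, rfl⟩ := hd
    exact key _ _ _ d

theorem Matrix.isUnit_submatrix_equiv' {R m n : Type*} [Ring R] [Fintype m] [DecidableEq m]
    [Fintype n] [DecidableEq n] (e : m ≃ n) {M : Matrix n n R} (hM : IsUnit M) :
    IsUnit (M.submatrix e e) :=
  hM.map (Matrix.reindexRingEquiv R e.symm)

theorem Matrix.dense_isUnit {R : Type*} [Ring R] [TopologicalSpace R]
    [IsTopologicalRing R] (hR : Dense {x : R | IsUnit x}) (ι : Type*) [Fintype ι]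
    [DecidableEq ι] : Dense {M : Matrix ι ι R | IsUnit M} := by
  classical
  have reindex : ∀ {m n : Type _} [Fintype m] [DecidableEq m] [Fintype n] [DecidableEq n]
      (e : m ≃ n), Dense {M : Matrix m m R | IsUnit M} → Dense {M : Matrix n n R | IsUnit M} := by
    intro m n _ _ _ _ e h M
    have hc : Continuous fun N : Matrix m m R => N.submatrix e.symm e.symm := by fun_prop
    have := map_mem_closure (t := {M : Matrix n n R | IsUnit M}) hc (h (M.submatrix e e)) fun N hN =>
      Matrix.isUnit_submatrix_equiv' e.symm hN
    simpa using this
  suffices ∀ d : DecidableEq ι, Dense {M : Matrix ι ι R | IsUnit M} from this _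
  refine Fintype.induction_empty_option (P := fun ι _ => ∀ d : DecidableEq ι,
    Dense {M : Matrix ι ι R | IsUnit M}) ?_ ?_ ?_ ι
  · intro α β _ e h d
    let := Fintype.ofEquiv _ e.symm
    exact reindex e (h _)
  · intro d M
    refine subset_closure ?_
    exact isUnit_of_subsingleton M
  · intro α _ h d
    have h1 := Matrix.dense_isUnit_sum_unit hR (h (Classical.decEq α))
    have := reindex (m := α ⊕ Unit) (n := Option α)
      ((Equiv.optionEquivSumPUnit α).symm) (by convert h1)
    convert this

open Matrix in
theorem Matrix.isUnit_one_add_vecMulVec_single {S ι : Type*} [Ring S] [Fintype ι] [DecidableEq ι]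
    (s : ι → S) (j : ι) (hs : s j = 0) :
    IsUnit (1 + vecMulVec s (Pi.single j 1)) := by
  have h0 : vecMulVec s (Pi.single j 1) * vecMulVec s (Pi.single j (1 : S)) = 0 := by
    rw [vecMulVec_mul_vecMulVec]
    simp [hs]
  refine ⟨⟨1 + vecMulVec s (Pi.single j 1), 1 - vecMulVec s (Pi.single j 1), ?_, ?_⟩, rfl⟩ <;>
    simp [mul_sub, sub_mul, add_mul, mul_add, h0]

open Matrix in
/-- A set of columns invariant under invertible matrices is saturated under adding left multiples
of one entry to the others. -/
theorem Matrix.mem_of_add_mul_mem {S ι : Type*} [Ring S] [Fintype ι] [DecidableEq ι]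
    {K : Set (ι → S)} (hinv : ∀ h : Matrix ι ι S, IsUnit h → ∀ c ∈ K, h *ᵥ c ∈ K)
    (s : ι → S) (j : ι) (hs : s j = 0) (c : ι → S) (h : (fun i => c i + s i * c j) ∈ K) :
    c ∈ K := by
  have := hinv _ (isUnit_one_add_vecMulVec_single (-s) j (by simp [hs])) _ h
  convert this using 1
  ext i
  simp [vecMulVec, mulVec, dotProduct, Matrix.one_apply, Pi.single_apply, hs,
    add_mul, Finset.sum_add_distrib]

section CentralPolynomials

variable {R S : Type*} [Ring R] [Ring S]

/-- Elements of the form `∑_{l < d} z ^ l * C (a l)`. -/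
def centralPolys (C : R →+* S) (z : S) (d : ℕ) : Set S :=
  {f | ∃ a : ℕ → R, f = ∑ l ∈ Finset.range d, z ^ l * C (a l)}

variable {C : R →+* S} {z : S} {d : ℕ} {f g : S}

theorem centralPolys.add (hf : f ∈ centralPolys C z d) (hg : g ∈ centralPolys C z d) :
    f + g ∈ centralPolys C z d := by
  obtain ⟨a, rfl⟩ := hf
  obtain ⟨b, rfl⟩ := hg
  exact ⟨a + b, by simp [mul_add, Finset.sum_add_distrib]⟩

theorem centralPolys.smul (hz : ∀ s, Commute z s) (r : R) (hf : f ∈ centralPolys C z d) :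
    C r * f ∈ centralPolys C z d := by
  obtain ⟨a, rfl⟩ := hf
  refine ⟨fun l => r * a l, ?_⟩
  rw [Finset.mul_sum]
  refine Finset.sum_congr rfl fun l _ => ?_
  rw [map_mul, ← mul_assoc, ← mul_assoc, ((hz (C r)).pow_left l).eq]

theorem centralPolys.succ_iff : f ∈ centralPolys C z (d + 1) ↔
    ∃ g ∈ centralPolys C z d, ∃ r, f = g + z ^ d * C r := by
  constructor
  · rintro ⟨a, rfl⟩
    exact ⟨_, ⟨a, rfl⟩, a d, Finset.sum_range_succ _ _⟩
  · rintro ⟨g, ⟨a, rfl⟩, r, rfl⟩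
    refine ⟨Function.update a d r, ?_⟩
    rw [Finset.sum_range_succ]
    simp only [Function.update_self]
    congr 1
    refine Finset.sum_congr rfl fun l hl => ?_
    rw [Function.update_of_ne (Finset.mem_range.1 hl).ne]

theorem centralPolys.zero_mem : (0 : S) ∈ centralPolys C z d := ⟨0, by simp⟩

theorem centralPolys.succ (hf : f ∈ centralPolys C z d) : f ∈ centralPolys C z (d + 1) :=
  succ_iff.2 ⟨f, hf, 0, by simp⟩

theorem centralPolys.mul_z (hf : f ∈ centralPolys C z d) : z * f ∈ centralPolys C z (d + 1) := by
  obtain ⟨a, rfl⟩ := hf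
  refine ⟨fun l => if l = 0 then 0 else a (l - 1), ?_⟩
  rw [Finset.sum_range_succ', Finset.mul_sum]
  simp [pow_succ', mul_assoc]

theorem centralPolys.monomial {l : ℕ} (hl : l < d) (r : R) :
    z ^ l * C r ∈ centralPolys C z d := by
  refine ⟨Pi.single l r, ?_⟩
  rw [Finset.sum_eq_single l]
  · simp
  · intro k _ hk
    simp [hk]
  · simp [hl]

open Matrix in
theorem centralPolys.column_mem [TopologicalSpace R] [TopologicalSpace S] [IsTopologicalRing R]
    [IsTopologicalRing S] (hR : Dense {x : R | IsUnit x}) (hC : Continuous C)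
    (hz : ∀ s, Commute z s) {ι : Type*} [Fintype ι] [DecidableEq ι] [Nonempty ι]
    {K : Set (ι ⊕ Unit → S)} (hK : IsClosed K)
    (hinv : ∀ h : Matrix (ι ⊕ Unit) (ι ⊕ Unit) S, IsUnit h → ∀ c ∈ K, h *ᵥ c ∈ K)
    (h0 : 0 ∈ K) (h1 : Pi.single (Sum.inr ()) 1 ∈ K) (d : ℕ) :
    ∀ p : ι ⊕ Unit → S, (∀ i, p i ∈ centralPolys C z d) → p ∈ K := by
  have hdense : ∀ (i : ι ⊕ Unit) (p : ι ⊕ Unit → S) (w : ι ⊕ Unit → R) (e : ℕ),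
      (∀ v : ι ⊕ Unit → R, IsUnit (v i) → (fun k => p k + z ^ e * C (v k)) ∈ K) →
      (fun k => p k + z ^ e * C (w k)) ∈ K := by
    intro i p w e h
    have hcont : Continuous fun r : R => (fun k => p k + z ^ e * C (Function.update w i r k)) := by
      have : Continuous fun r : R => Function.update w i r := by fun_prop
      fun_prop
    have := map_mem_closure (t := K) hcont (hR (w i)) fun r hr => h _ (by simpa using hr)
    rw [hK.closure_eq] at this
    simpa using this
  have hlead : ∀ d, (∀ p : ι ⊕ Unit → S, (∀ i, p i ∈ centralPolys C z d) → ∀ b : Rˣ,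
      (fun k => p k + z ^ d * C ((Pi.single (Sum.inr ()) (b : R) : ι ⊕ Unit → R) k)) ∈ K) →
      ∀ p : ι ⊕ Unit → S, (∀ i, p i ∈ centralPolys C z (d + 1)) → p ∈ K := by
    intro d hd p hp
    choose q hq w hw using fun i => centralPolys.succ_iff.1 (hp i)
    rw [funext hw]
    refine hdense (Sum.inr ()) q w d fun v hv => ?_
    obtain ⟨b, hb⟩ := hv
    refine mem_of_add_mul_mem hinv (fun i => if i = Sum.inr () then 0 else -C (v i * ↑b⁻¹))
      (Sum.inr ()) (by simp) _ ?_
    convert hd (fun i => if i = Sum.inr () then q i else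
      q i + C (-(v i * ↑b⁻¹)) * q (Sum.inr ())) ?_ b using 1
    · ext k
      by_cases hk : k = Sum.inr ()
      · subst hk; simp [hb]
      · have hzC : ∀ r : R, C r * z ^ d = z ^ d * C r := fun r => (((hz (C r)).pow_left d).eq).symm
        have : C (v k * ↑b⁻¹) * (z ^ d * C (v (Sum.inr ()))) = z ^ d * C (v k) := by
          rw [← hb, ← mul_assoc, hzC, mul_assoc, ← map_mul]; simp
        simp only [hk, if_false, Pi.single_apply, map_zero, mul_zero, add_zero, mul_add, neg_mul,
          this, map_neg]
        abel
    · intro i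
      split_ifs
      · exact hq i
      · exact centralPolys.add (hq i) (centralPolys.smul hz _ (hq _))
  induction d with
  | zero =>
    intro p hp
    have : p = 0 := by
      ext i
      obtain ⟨a, ha⟩ := hp i
      simpa using ha
    rwa [this]
  | succ d ih =>
    refine hlead d ?_
    intro p hp b
    cases d with
    | zero =>
      have hp0 : p = 0 := by
        ext i
        obtain ⟨a, ha⟩ := hp i
        simpa using ha
      have hu : IsUnit (Matrix.diagonal fun _ : ι ⊕ Unit => C (b : R)) :=
        ⟨⟨diagonal fun _ => C (b : R), diagonal fun _ => C ((b⁻¹ : Rˣ) : R),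
          by simp [← map_mul], by simp [← map_mul]⟩, rfl⟩
      convert hinv _ hu _ h1 using 1
      ext k
      rw [mulVec_diagonal]
      by_cases hk : k = Sum.inr () <;> simp [hp0, hk]
    | succ e =>
      obtain ⟨i₁⟩ := ‹Nonempty ι›
      choose q hq w hw using fun i => centralPolys.succ_iff.1 (hp i)
      have hre : (fun k => p k + z ^ (e + 1) *
          C ((Pi.single (Sum.inr ()) (b : R) : ι ⊕ Unit → R) k)) =
          fun k => (q k + z ^ (e + 1) * C ((Pi.single (Sum.inr ()) (b : R) : ι ⊕ Unit → R) k)) +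
            z ^ e * C (w k) := by
        ext k; rw [hw k]; abel
      rw [hre]
      refine hdense (Sum.inl i₁) _ w e fun v hv => ?_
      obtain ⟨u, hu⟩ := hv
      refine mem_of_add_mul_mem hinv (Pi.single (Sum.inr ()) (-(z * C (b * ↑u⁻¹))))
        (Sum.inl i₁) (by simp) _ ?_
      refine ih _ fun i => ?_
      by_cases hi : i = Sum.inr ()
      · subst hi
        have : z * C (b * ↑u⁻¹) * (z ^ e * C (v (Sum.inl i₁))) = z ^ (e + 1) * C b := by
          have hzC : C ((b : R) * ↑u⁻¹) * z ^ e = z ^ e * C (b * ↑u⁻¹) :=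
            (((hz (C (b * ↑u⁻¹))).pow_left e).eq).symm
          rw [← hu, pow_succ', mul_assoc, ← mul_assoc (C _), hzC, mul_assoc (z ^ e), ← map_mul]
          simp [mul_assoc]
        have e1 : q (Sum.inr ()) + z ^ (e + 1) * C (b : R) + z ^ e * C (v (Sum.inr ())) +
            -(z * C (b * ↑u⁻¹)) * (q (Sum.inl i₁) + z ^ e * C (v (Sum.inl i₁))) =
            (q (Sum.inr ()) + z ^ e * C (v (Sum.inr ()))) +
              z * (C (-(b * ↑u⁻¹)) * q (Sum.inl i₁)) := by
          rw [mul_add, neg_mul _ (z ^ e * _), this, map_neg]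
          simp only [neg_mul, mul_neg, mul_assoc]
          abel
        simp only [Pi.single_eq_same, Pi.single_apply, reduceCtorEq, if_false, map_zero,
          mul_zero, add_zero]
        rw [e1]
        exact centralPolys.add (centralPolys.succ_iff.2 ⟨_, hq _, _, rfl⟩)
          (centralPolys.mul_z (centralPolys.smul hz _ (hq _)))
      · simp only [Pi.single_apply, hi, if_false, map_zero, mul_zero, add_zero, zero_mul]
        exact centralPolys.succ_iff.2 ⟨_, hq i, _, rfl⟩

end CentralPolynomials

theorem exists_finite_partitionOfUnity {X ι : Type*} [TopologicalSpace X] [CompactSpace X]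
    [T2Space X] [Fintype ι] (U : ι → Set X) (hU : ∀ i, IsOpen (U i)) (hc : ∀ x, ∃ i, x ∈ U i) :
    ∃ φ : ι → C(X, ℝ), (∀ i x, 0 ≤ φ i x) ∧ (∀ x, ∑ i, φ i x = 1) ∧
      ∀ i x, φ i x ≠ 0 → x ∈ U i := by
  obtain ⟨f, hf⟩ := PartitionOfUnity.exists_isSubordinate (s := Set.univ) isClosed_univ U hU
    fun x _ => Set.mem_iUnion.2 (hc x)
  refine ⟨fun i => f i, fun i x => f.nonneg i x, fun x => ?_, fun i x hx => ?_⟩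
  · rw [← finsum_eq_sum_of_fintype]
    exact f.sum_eq_one (Set.mem_univ x)
  · exact hf i (subset_tsupport _ hx)

/-- The function `t ↦ φ t • v`. -/
def ContinuousMap.smulVec {X V : Type*} [TopologicalSpace X] [NormedAddCommGroup V]
    [NormedSpace ℂ V] (φ : C(X, ℂ)) : V →ₗ[ℂ] C(X, V) where
  toFun v := ⟨fun t => φ t • v, by fun_prop⟩
  map_add' v w := by ext; simp
  map_smul' c v := by ext t; exact smul_comm _ _ _

theorem ContinuousMap.exists_sum_smulVec_near {X V : Type*} [TopologicalSpace X] [CompactSpace X]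
    [T2Space X] [NormedAddCommGroup V] [NormedSpace ℂ V] (f : C(X, V)) {ε : ℝ} (hε : 0 < ε) :
    ∃ (s : Finset X) (φ : s → C(X, ℂ)) (v : s → V), ‖f - ∑ i, (φ i).smulVec (v i)‖ ≤ ε := by
  obtain ⟨s, hs⟩ := isCompact_univ.elim_nhds_subcover (fun x : X => {y | ‖f y - f x‖ < ε})
    (fun x _ => IsOpen.mem_nhds (isOpen_lt (by fun_prop) continuous_const) (by simpa using hε))
  obtain ⟨φ, h0, h1, h2⟩ := exists_finite_partitionOfUnity
    (fun x : s => {y | ‖f y - f x‖ < ε})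
    (fun x => isOpen_lt (by fun_prop) continuous_const) (fun x => by
      obtain ⟨y, hy, hxy⟩ := Set.mem_iUnion₂.1 (hs.2 (Set.mem_univ x))
      exact ⟨⟨y, hy⟩, hxy⟩)
  refine ⟨s, fun i => ⟨fun t => (φ i t : ℂ), by fun_prop⟩, fun i => f i,
    (ContinuousMap.norm_le _ hε.le).2 fun t => ?_⟩
  have e : (f - ∑ i : s, (⟨fun t => (φ i t : ℂ), by fun_prop⟩ : C(X, ℂ)).smulVec (f i)) t =
      ∑ i : s, ((φ i t : ℝ) : ℂ) • (f t - f i) := by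
    simp only [smul_sub, Finset.sum_sub_distrib, ← Finset.sum_smul, ← Complex.ofReal_sum, h1]
    simp [ContinuousMap.smulVec, ContinuousMap.sum_apply]
  rw [e]
  calc _ ≤ ∑ i : s, φ i t * ε := by
        refine norm_sum_le_of_le _ fun i _ => ?_
        rw [norm_smul, Complex.norm_real, Real.norm_of_nonneg (h0 i t)]
        by_cases h : φ i t = 0
        · simp [h]
        · exact mul_le_mul_of_nonneg_left (h2 i t h).le (h0 i t)
    _ = ε := by rw [← Finset.sum_mul, h1, one_mul]

theorem ContinuousMap.continuous_smulVec_left {X V : Type*} [TopologicalSpace X] [CompactSpace X]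
    [NormedAddCommGroup V] [NormedSpace ℂ V] (v : V) :
    Continuous fun φ : C(X, ℂ) => φ.smulVec v :=
  ContinuousMap.continuous_postcomp (⟨fun c : ℂ => c • v, by fun_prop⟩ : C(ℂ, V))

/-- Laurent polynomials with vector coefficients are dense in the functions on the circle. -/
theorem dense_range_lsum_fourier (V : Type*) [NormedAddCommGroup V] [NormedSpace ℂ V] :
    Dense (LinearMap.range (Finsupp.lsum ℂ (M := V) fun k : ℤ =>
      (fourier k : C(AddCircle (1 : ℝ), ℂ)).smulVec) : Set C(AddCircle (1 : ℝ), V)) := by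
  set L := LinearMap.range (Finsupp.lsum ℂ (M := V) fun k : ℤ =>
      (fourier k : C(AddCircle (1 : ℝ), ℂ)).smulVec) with hL
  have h1 : ∀ (φ : C(AddCircle (1 : ℝ), ℂ)) (v : V), φ.smulVec v ∈ L.topologicalClosure := by
    intro φ v
    have hφ : φ ∈ closure (Submodule.span ℂ (Set.range (fourier (T := 1))) : Set _) := by
      rw [← Submodule.topologicalClosure_coe, span_fourier_closure_eq_top]
      trivial
    refine map_mem_closure (f := fun φ : C(AddCircle (1 : ℝ), ℂ) => φ.smulVec v)
      (ContinuousMap.continuous_smulVec_left v) hφ fun ψ hψ => ?_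
    induction hψ using Submodule.span_induction with
    | mem x hx =>
      obtain ⟨k, rfl⟩ := hx
      exact ⟨Finsupp.single k v, by simp⟩
    | zero =>
      refine (congrArg (· ∈ L) ?_).mpr (L.zero_mem)
      exact ContinuousMap.ext fun t => by simp [ContinuousMap.smulVec]
    | add x y _ _ hx hy =>
      refine (congrArg (· ∈ L) ?_).mpr (L.add_mem hx hy)
      exact ContinuousMap.ext fun t => by simp [ContinuousMap.smulVec, add_smul]
    | smul c x _ hx =>
      refine (congrArg (· ∈ L) ?_).mpr (L.smul_mem c hx)
      exact ContinuousMap.ext fun t => by simp [ContinuousMap.smulVec, mul_smul]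
  intro f
  rw [← Submodule.topologicalClosure_coe,
    ← (Submodule.isClosed_topologicalClosure L).closure_eq, Metric.mem_closure_iff]
  intro ε hε
  obtain ⟨s, φ, v, h⟩ := f.exists_sum_smulVec_near (half_pos hε)
  refine ⟨∑ i, (φ i).smulVec (v i), Submodule.sum_mem _ fun i _ => h1 (φ i) (v i), ?_⟩
  rw [dist_eq_norm]
  exact h.trans_lt (half_lt_self hε)

open Matrix in
/-- If the units of `R` are dense, then columns which extend to invertible matrices are dense over
the ring of `R`-valued functions on the circle. -/
theorem dense_column_circle {R : Type*} [NormedRing R] [NormedAlgebra ℂ R]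
    (hR : Dense {x : R | IsUnit x}) {ι : Type*} [Fintype ι] [DecidableEq ι] [Nonempty ι] :
    Dense {c : ι ⊕ Unit → C(AddCircle (1 : ℝ), R) | ∃ h : Matrix (ι ⊕ Unit) (ι ⊕ Unit) _,
      IsUnit h ∧ h *ᵥ Pi.single (Sum.inr ()) 1 = c} := by
  obtain ⟨D, hD⟩ : ∃ D : Set (ι ⊕ Unit → C(AddCircle (1 : ℝ), R)), D = {c | ∃ h : Matrix (ι ⊕ Unit) (ι ⊕ Unit) C(AddCircle (1 : ℝ), R),
      IsUnit h ∧ h *ᵥ Pi.single (Sum.inr ()) 1 = c} := ⟨_, rfl⟩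
  have hmem : ∀ c, c ∈ D ↔ ∃ h : Matrix (ι ⊕ Unit) (ι ⊕ Unit) C(AddCircle (1 : ℝ), R),
      IsUnit h ∧ h *ᵥ Pi.single (Sum.inr ()) 1 = c := fun c => by rw [hD]; rfl
  change Dense {c : ι ⊕ Unit → C(AddCircle (1 : ℝ), R) | ∃ h : Matrix (ι ⊕ Unit) (ι ⊕ Unit) C(AddCircle (1 : ℝ), R),
      IsUnit h ∧ h *ᵥ Pi.single (Sum.inr ()) 1 = c}
  rw [← hD]
  have hinv : ∀ h : Matrix (ι ⊕ Unit) (ι ⊕ Unit) C(AddCircle (1 : ℝ), R), IsUnit h → ∀ c ∈ closure D,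
      h *ᵥ c ∈ closure D := by
    intro h hh c hc
    refine map_mem_closure (f := fun c => h *ᵥ c) (by fun_prop) hc fun c hc => ?_
    obtain ⟨g, hg, rfl⟩ := (hmem c).1 hc
    exact (hmem _).2 ⟨h * g, hh.mul hg, (mulVec_mulVec _ _ _).symm⟩
  have h1 : Pi.single (Sum.inr ()) 1 ∈ D := (hmem _).2 ⟨1, isUnit_one, one_mulVec _⟩
  have hsc : ∀ u : C(AddCircle (1 : ℝ), R), IsUnit u → Pi.single (Sum.inr ()) u ∈ D := by
    rintro _ ⟨u, rfl⟩
    refine (hmem _).2 ⟨diagonal fun _ => (u : C(AddCircle (1 : ℝ), R)), ⟨⟨diagonal fun _ => (u : C(AddCircle (1 : ℝ), R)),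
      diagonal fun _ => ((u⁻¹ : (C(AddCircle (1 : ℝ), R))ˣ) : C(AddCircle (1 : ℝ), R)), by simp, by simp⟩, rfl⟩, ?_⟩
    ext1 k
    rw [mulVec_diagonal]
    by_cases hk : k = Sum.inr () <;> simp [hk]
  have h0 : (0 : ι ⊕ Unit → C(AddCircle (1 : ℝ), R)) ∈ closure D := by
    have hc : Continuous fun x : ℂ =>
        (Pi.single (Sum.inr ()) (algebraMap ℂ C(AddCircle (1 : ℝ), R) x) : ι ⊕ Unit → C(AddCircle (1 : ℝ), R)) := by
      have : Continuous (algebraMap ℂ C(AddCircle (1 : ℝ), R)) := by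
        have : (algebraMap ℂ C(AddCircle (1 : ℝ), R) : ℂ → C(AddCircle (1 : ℝ), R)) = fun x => x • 1 := by
          ext1 x; rw [Algebra.algebraMap_eq_smul_one]
        rw [this]; fun_prop
      exact (continuous_single _).comp this
    have hd : (0 : ℂ) ∈ closure ({0}ᶜ : Set ℂ) := by
      rw [(dense_compl_singleton (0 : ℂ)).closure_eq]; trivial
    have := map_mem_closure hc hd (t := D) fun x hx => hsc _ ((IsUnit.mk0 x hx).map _)
    simpa using this
  let C : R →+* C(AddCircle (1 : ℝ), R) :=
    { toFun := ContinuousMap.const _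
      map_one' := rfl
      map_mul' := fun _ _ => rfl
      map_zero' := rfl
      map_add' := fun _ _ => rfl }
  have hC : Continuous C := ContinuousMap.continuous_const'
  let ζ : ℤ → C(AddCircle (1 : ℝ), R) := fun k => (fourier k).smulVec 1
  have hζ : ∀ k l, ζ (k + l) = ζ k * ζ l := fun k l => by
    ext t
    simp [ζ, ContinuousMap.smulVec, fourier_add', smul_smul, mul_comm]
  have hζ0 : ζ 0 = 1 := by
    ext t
    simp [ζ, ContinuousMap.smulVec]
  have hζn : ∀ l : ℕ, ζ l = ζ 1 ^ l := fun l => by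
    induction l with
    | zero => simpa using hζ0
    | succ l ih => rw [Nat.cast_succ, hζ, ih, pow_succ]
  have hz : ∀ s, Commute (ζ 1) s := fun s => by
    ext t
    simp [ζ, ContinuousMap.smulVec]
  have hK := centralPolys.column_mem hR hC hz isClosed_closure hinv h0 (subset_closure h1)
  intro c
  let Ψ : C(AddCircle (1 : ℝ), ι ⊕ Unit → R) → (ι ⊕ Unit → C(AddCircle (1 : ℝ), R)) :=
    fun f i => ⟨fun t => f t i, by fun_prop⟩
  have hΨ : Continuous Ψ := by
    refine continuous_pi fun i => ?_
    exact ContinuousMap.continuous_postcomp (⟨fun v => v i, by fun_prop⟩ : C(ι ⊕ Unit → R, R))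
  let f : C(AddCircle (1 : ℝ), ι ⊕ Unit → R) := ⟨fun t i => c i t, by fun_prop⟩
  have := map_mem_closure (t := closure D) hΨ (dense_range_lsum_fourier (ι ⊕ Unit → R) f) ?_
  · rwa [closure_closure] at this
  rintro _ ⟨a, rfl⟩
  obtain ⟨N, hN⟩ : ∃ N : ℕ, ∀ k ∈ a.support, -(N : ℤ) ≤ k ∧ k < N := by
    refine ⟨∑ k ∈ a.support, (k.natAbs + 1), fun k hk => ?_⟩
    have := Finset.single_le_sum (f := fun k : ℤ => k.natAbs + 1) (fun _ _ => Nat.zero_le _) hk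
    omega
  have hu : IsUnit (Matrix.diagonal fun _ : ι ⊕ Unit => ζ (-(N : ℤ))) := by
    refine ⟨⟨diagonal fun _ => ζ (-(N : ℤ)), diagonal fun _ => ζ N, ?_, ?_⟩, rfl⟩ <;>
      simp [← hζ, hζ0]
  have hp := hK (2 * N) (fun i => ζ N * Ψ (Finsupp.lsum ℂ (M := ι ⊕ Unit → R) (fun k : ℤ =>
    (fourier k : C(AddCircle (1 : ℝ), ℂ)).smulVec) a) i) fun i => ?_
  · convert hinv _ hu _ hp using 1
    ext1 k
    rw [mulVec_diagonal, ← mul_assoc, ← hζ]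
    simp [hζ0]
  · have : ζ N * Ψ (Finsupp.lsum ℂ (M := ι ⊕ Unit → R) (fun k : ℤ =>
        (fourier k : C(AddCircle (1 : ℝ), ℂ)).smulVec) a) i =
        ∑ k ∈ a.support, ζ 1 ^ (k + N).toNat * C (a k i) := by
      have e : Ψ (Finsupp.lsum ℂ (M := ι ⊕ Unit → R) (fun k : ℤ =>
        (fourier k : C(AddCircle (1 : ℝ), ℂ)).smulVec) a) i =
        ∑ k ∈ a.support, ζ k * C (a k i) := by
        ext t
        have hCt : ∀ r t, C r t = r := fun _ _ => rfl
        simp [Ψ, Finsupp.sum, ContinuousMap.sum_apply, ζ, hCt, ContinuousMap.smulVec]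
      rw [e, Finset.mul_sum]
      refine Finset.sum_congr rfl fun k hk => ?_
      rw [← mul_assoc, ← hζ, ← hζn, Int.toNat_of_nonneg (by linarith [(hN k hk).1]), add_comm]
    rw [this]
    refine Finset.sum_induction _ (· ∈ centralPolys C (ζ 1) (2 * N)) (fun _ _ => centralPolys.add)
      centralPolys.zero_mem fun k hk => centralPolys.monomial ?_ _
    have := hN k hk
    omega

attribute [local instance] Matrix.linftyOpNormedRing in
theorem Matrix.continuousOn_ringInverse {R ι : Type*} [NormedRing R] [CompleteSpace R] [Fintype ι]
    [DecidableEq ι] : ContinuousOn Ring.inverse {M : Matrix ι ι R | IsUnit M} := by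
  rintro _ ⟨u, rfl⟩
  have : @CompleteSpace (Matrix ι ι R) PseudoMetricSpace.toUniformSpace :=
    inferInstanceAs (CompleteSpace (ι → ι → R))
  exact (NormedRing.inverse_continuousAt u).continuousWithinAt

open Matrix in
theorem Matrix.isUnit_toBlocks₁₁ {R ι : Type*} [Ring R] [Fintype ι] [DecidableEq ι]
    {M : Matrix (ι ⊕ Unit) (ι ⊕ Unit) R} (hM : IsUnit M)
    (hc : M *ᵥ Pi.single (Sum.inr ()) 1 = Pi.single (Sum.inr ()) 1) : IsUnit M.toBlocks₁₁ := by
  obtain ⟨u, rfl⟩ := hM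
  have hc' : (↑u⁻¹ : Matrix (ι ⊕ Unit) (ι ⊕ Unit) R) *ᵥ Pi.single (Sum.inr ()) 1 =
      Pi.single (Sum.inr ()) 1 := by
    rw [← hc, mulVec_mulVec, u.inv_mul, one_mulVec, hc]
  have key : ∀ P Q : Matrix (ι ⊕ Unit) (ι ⊕ Unit) R,
      Q *ᵥ Pi.single (Sum.inr ()) 1 = Pi.single (Sum.inr ()) 1 →
      P *ᵥ Pi.single (Sum.inr ()) 1 = Pi.single (Sum.inr ()) 1 → P * Q = 1 →
      P.toBlocks₁₁ * Q.toBlocks₁₁ = 1 := by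
    intro P Q _ hP h
    have h2 : P.toBlocks₁₂ = 0 := by
      ext i j
      have := congrFun hP (Sum.inl i)
      simpa [toBlocks₁₂] using this
    rw [← fromBlocks_toBlocks P, ← fromBlocks_toBlocks Q, fromBlocks_multiply, h2,
      ← fromBlocks_one, fromBlocks_inj] at h
    simpa using h.1
  exact ⟨⟨_, _, key _ _ hc' hc u.mul_inv, key _ _ hc hc' u.inv_mul⟩, rfl⟩

theorem exists_circle_lift {R : Type*} [TopologicalSpace R] (f : ℝ → R) (h : f 0 = f 1)
    (hf : ContinuousOn f (Set.Icc 0 1)) :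
    ∃ F : C(AddCircle (1 : ℝ), R), ∀ t ∈ Set.Icc (0 : ℝ) 1, F t = f t := by
  refine ⟨⟨AddCircle.liftIco 1 0 f, AddCircle.liftIco_zero_continuous h hf⟩, fun t ht => ?_⟩
  obtain h1 | rfl := ht.2.lt_or_eq
  · exact AddCircle.liftIco_zero_coe_apply ⟨ht.1, h1⟩
  · have : ((1 : ℝ) : AddCircle (1 : ℝ)) = ((0 : ℝ) : AddCircle (1 : ℝ)) := by
      rw [AddCircle.coe_period]; rfl
    rw [this]
    simpa [h] using AddCircle.liftIco_zero_coe_apply (p := (1 : ℝ)) (f := f) (x := 0) (by simp)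

open Matrix in
/-- A unimodular column over the circle which is close enough to a completable one is
completable. -/
theorem exists_completion_of_unimodular {S n : Type*} [NormedRing S] [CompleteSpace S] [Fintype n]
    [DecidableEq n] (e : n → S)
    (hd : Dense {c : n → S | ∃ h : Matrix n n S, IsUnit h ∧ h *ᵥ e = c})
    (r c : n → S) (hrc : r ⬝ᵥ c = 1) : ∃ h : Matrix n n S, IsUnit h ∧ h *ᵥ e = c := by
  have hc : Continuous fun c' : n → S => r ⬝ᵥ c' := by
    unfold dotProduct; fun_prop
  obtain ⟨c', hc', h, hh, he⟩ := hd.inter_open_nonempty _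
    (Units.isOpen.preimage hc) ⟨c, by simp [hrc]⟩
  obtain ⟨u, hu⟩ := hc'
  have hu' : r ⬝ᵥ (c' - c) = u - 1 := by rw [dotProduct_sub, hrc, hu]
  have hM : IsUnit (1 + vecMulVec (c' - c) r) := by
    set d := c' - c
    have hu1 : (u : S) * ↑u⁻¹ = 1 := u.mul_inv
    have hu2 : ↑u⁻¹ * (u : S) = 1 := u.inv_mul
    have e1 : vecMulVec d r * vecMulVec d ((↑u⁻¹ : S) • r) =
        vecMulVec d r - vecMulVec d ((↑u⁻¹ : S) • r) := by
      ext i j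
      rw [vecMulVec_mul_vecMulVec, hu']
      simp [vecMulVec_apply, sub_mul, ← mul_assoc, mul_sub]
    have e2 : vecMulVec d ((↑u⁻¹ : S) • r) * vecMulVec d r =
        vecMulVec d r - vecMulVec d ((↑u⁻¹ : S) • r) := by
      ext i j
      rw [vecMulVec_mul_vecMulVec, smul_dotProduct, hu']
      simp [vecMulVec_apply, sub_mul, mul_sub]
    refine ⟨⟨1 + vecMulVec d r, 1 - vecMulVec d ((↑u⁻¹ : S) • r), ?_, ?_⟩, rfl⟩
    · rw [add_mul, mul_sub, mul_sub, e1]; simp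
    · rw [sub_mul, mul_add, mul_add, e2]; simp
  obtain ⟨M, hM⟩ := hM
  have hMc : (M : Matrix n n S) *ᵥ c = c' := by
    rw [hM, add_mulVec, one_mulVec, vecMulVec_mulVec, hrc]
    simp
  refine ⟨(↑M⁻¹ : Matrix n n S) * h, M⁻¹.isUnit.mul hh, ?_⟩
  rw [← mulVec_mulVec, he, ← hMc, mulVec_mulVec, M.inv_mul, one_mulVec]

open Matrix in
/-- Over a ring with dense units, a matrix which becomes connected to the identity after adding
one dimension is already connected to the identity. -/
theorem joinedIn_isUnit_of_fromBlocks {R : Type*} [NormedRing R] [NormedAlgebra ℂ R]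
    [CompleteSpace R] (hR : Dense {x : R | IsUnit x}) {ι : Type*} [Fintype ι] [DecidableEq ι]
    [Nonempty ι] {V : Matrix ι ι R}
    (h : JoinedIn {M : Matrix (ι ⊕ Unit) (ι ⊕ Unit) R | IsUnit M} 1 (fromBlocks V 0 0 1)) :
    JoinedIn {M : Matrix ι ι R | IsUnit M} 1 V := by
  set γ : C(ℝ, Matrix (ι ⊕ Unit) (ι ⊕ Unit) R) := h.somePath.extend with hγ
  have hγc : Continuous γ := γ.continuous
  have hγu : ∀ t ∈ Set.Icc (0 : ℝ) 1, IsUnit (γ t) := by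
    intro t ht
    rw [hγ, Path.extend_apply _ ht]
    exact h.somePath_mem _
  have hγ0 : γ 0 = 1 := by simp [hγ]
  have hγ1 : γ 1 = fromBlocks V 0 0 1 := by simp [hγ]
  have hγi : ContinuousOn (fun t => Ring.inverse (γ t)) (Set.Icc 0 1) :=
    Matrix.continuousOn_ringInverse.comp hγc.continuousOn hγu
  have hγi1 : Ring.inverse (γ 1) * γ 1 = 1 := Ring.inverse_mul_cancel _ (hγu 1 (by simp))
  have hlast : ∀ i, (fromBlocks V 0 0 1 : Matrix (ι ⊕ Unit) (ι ⊕ Unit) R) i (Sum.inr ()) =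
      (1 : Matrix (ι ⊕ Unit) (ι ⊕ Unit) R) i (Sum.inr ()) := by
    rintro (i | i) <;> simp
  choose c hc using fun i => exists_circle_lift (fun t => γ t i (Sum.inr ()))
    (by simp only [hγ0, hγ1, hlast]) (by fun_prop)
  have hrow : ∀ j, Ring.inverse (γ 1) (Sum.inr ()) j = Ring.inverse (γ 0) (Sum.inr ()) j := by
    intro j
    rw [hγ0, Ring.inverse_one]
    have h1 := hγi1
    rw [hγ1] at h1 ⊢
    have h2 := hγu 1 (by simp)
    rw [hγ1] at h2
    have h3 := Ring.mul_inverse_cancel _ h2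
    have h4 : ∀ i, ((fromBlocks V 0 0 1 *
      Ring.inverse (fromBlocks V 0 0 1) : Matrix (ι ⊕ Unit) (ι ⊕ Unit) R)) (Sum.inr ()) i = Ring.inverse (fromBlocks V 0 0 1)
        (Sum.inr ()) i := by
      intro i
      simp [Matrix.mul_apply, Fintype.sum_sum_type]
    rw [← h4, h3]
  choose r hr using fun j => exists_circle_lift (fun t => Ring.inverse (γ t) (Sum.inr ()) j)
    (hrow j).symm (by
      have : Continuous fun M : Matrix (ι ⊕ Unit) (ι ⊕ Unit) R => M (Sum.inr ()) j := by fun_prop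
      exact this.comp_continuousOn hγi)
  have hrc : r ⬝ᵥ c = 1 := by
    ext x
    obtain ⟨t, ht, rfl⟩ : x ∈ ((↑) : ℝ → AddCircle (1 : ℝ)) '' Set.Icc 0 (0 + 1) := by
      rw [AddCircle.coe_image_Icc_eq]; trivial
    rw [zero_add] at ht
    have := congrArg (fun M : Matrix (ι ⊕ Unit) (ι ⊕ Unit) R => M (Sum.inr ()) (Sum.inr ()))
      (Ring.inverse_mul_cancel _ (hγu t ht))
    simp only [Matrix.mul_apply, Matrix.one_apply_eq] at this
    rw [dotProduct, ContinuousMap.sum_apply]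
    simpa [hr _ t ht, hc _ t ht] using this
  obtain ⟨_, ⟨H, rfl⟩, hHc⟩ := exists_completion_of_unimodular _ (dense_column_circle hR) r c hrc
  let ev : ℝ → C(AddCircle (1 : ℝ), R) →+* R := fun t =>
    { toFun := fun f => f t
      map_one' := rfl
      map_mul' := fun _ _ => rfl
      map_zero' := rfl
      map_add' := fun _ _ => rfl }
  let K : ℝ → Matrix (ι ⊕ Unit) (ι ⊕ Unit) R := fun t =>
    (ev t).mapMatrix (↑H⁻¹ : Matrix (ι ⊕ Unit) (ι ⊕ Unit) C(AddCircle (1 : ℝ), R)) * γ t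
  have hKc : Continuous K := by
    refine Continuous.mul (continuous_matrix fun i j => ?_) hγc
    exact (map_continuous ((↑H⁻¹ : Matrix (ι ⊕ Unit) (ι ⊕ Unit) C(AddCircle (1 : ℝ), R)) i j)).comp
      (AddCircle.continuous_mk' 1)
  have hKu : ∀ t ∈ Set.Icc (0 : ℝ) 1, IsUnit (K t).toBlocks₁₁ := by
    intro t ht
    refine isUnit_toBlocks₁₁ ((H⁻¹.isUnit.map (ev t).mapMatrix).mul (hγu t ht)) ?_
    have e1 : γ t *ᵥ Pi.single (Sum.inr ()) 1 = fun i => ev t (c i) := by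
      ext i
      rw [mulVec_single_one]
      exact (hc i t ht).symm
    have e2 : (↑H⁻¹ : Matrix (ι ⊕ Unit) (ι ⊕ Unit) C(AddCircle (1 : ℝ), R)) *ᵥ c =
        Pi.single (Sum.inr ()) 1 := by
      rw [← hHc, mulVec_mulVec, H.inv_mul, one_mulVec]
    rw [← mulVec_mulVec, e1]
    ext i
    have := congrArg (ev t) (congrFun e2 i)
    rw [mulVec, dotProduct, map_sum] at this
    simp only [map_mul] at this
    rw [mulVec, dotProduct]
    refine this.trans ?_
    by_cases hi : i = Sum.inr () <;> simp [hi]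
  obtain ⟨m, hm⟩ := hKu 0 (by simp)
  have h01 : ev 1 = ev 0 := by
    ext f
    have : ((1 : ℝ) : AddCircle (1 : ℝ)) = ((0 : ℝ) : AddCircle (1 : ℝ)) := by
      rw [AddCircle.coe_period]; rfl
    exact congrArg f this
  have hK1 : (K 1).toBlocks₁₁ = m * V := by
    rw [hm]
    simp only [K, h01, hγ0, hγ1, mul_one]
    generalize (ev 0).mapMatrix
      (↑H⁻¹ : Matrix (ι ⊕ Unit) (ι ⊕ Unit) C(AddCircle (1 : ℝ), R)) = P
    rw [← fromBlocks_toBlocks P, fromBlocks_multiply]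
    simp
  refine JoinedIn.ofLine (f := fun t => (↑m⁻¹ : Matrix ι ι R) * (K t).toBlocks₁₁) ?_ ?_ ?_ ?_
  · have : Continuous fun t => (K t).toBlocks₁₁ :=
      continuous_matrix fun i j => hKc.matrix_elem _ _
    exact (continuous_const.mul this).continuousOn
  · simp [← hm]
  · simp [hK1, ← mul_assoc]
  · rintro _ ⟨t, ht, rfl⟩
    exact m⁻¹.isUnit.mul (hKu t ht)

/-- The unitary part of the polar decomposition is a retraction of the invertible elements of a
unital C⋆-algebra onto the unitary elements. -/
lemma CStarAlgebra.exists_unitary_retraction (E : Type*) [CStarAlgebra E] :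
    ∃ U : E → E, ContinuousOn U {x | IsUnit x} ∧ (∀ v, IsUnit v → U v ∈ unitary E) ∧
      (∀ u ∈ unitary E, U u = u) ∧ ∀ v, IsUnit v → JoinedIn {x : E | IsUnit x} v (U v) := by
  let _ := CStarAlgebra.spectralOrder E
  have := CStarAlgebra.spectralOrderedRing E
  have hsp : ∀ v : E, IsUnit v → IsStrictlyPositive (star v * v) := fun v hv ↦
    (hv.star.mul hv).isStrictlyPositive (star_mul_self_nonneg v)
  refine ⟨fun v ↦ v * (star v * v) ^ (-(1 / 2) : ℝ), ?_, ?_, ?_, ?_⟩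
  · refine continuousOn_id.mul ?_
    exact (CFC.continuousOn_rpow (A := E) (-(1 / 2))).comp (by fun_prop) fun v hv ↦ hsp v hv
  · intro v hv
    have h := hsp v hv
    have hu : IsUnit (v * (star v * v) ^ (-(1 / 2) : ℝ)) := hv.mul (h.rpow _ _).isUnit
    have hs : star ((star v * v) ^ (-(1 / 2) : ℝ)) = (star v * v) ^ (-(1 / 2) : ℝ) :=
      (h.rpow _ _).isSelfAdjoint.star_eq
    have h1 : star (v * (star v * v) ^ (-(1 / 2) : ℝ)) * (v * (star v * v) ^ (-(1 / 2) : ℝ)) = 1 := by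
      rw [star_mul, hs, ← CFC.conjugate_rpow_neg_one_half (star v * v) h]
      simp only [mul_assoc]
    exact ⟨h1, by
      obtain ⟨w, hw⟩ := hu
      change v * (star v * v) ^ (-(1 / 2) : ℝ) * star (v * (star v * v) ^ (-(1 / 2) : ℝ)) = 1
      rw [← hw] at h1 ⊢
      rw [← Units.inv_eq_of_mul_eq_one_left h1]
      simp⟩
  · intro u hu
    simp [Unitary.star_mul_self_of_mem hu, CFC.one_rpow]
  · intro v hv
    have h := (hsp v hv).rpow _ (-(1 / 2) : ℝ)
    refine JoinedIn.ofLine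
      (f := fun τ : ℝ ↦ v * ((1 - τ) • (1 : E) + τ • (star v * v) ^ (-(1 / 2) : ℝ)))
      (by fun_prop) (by simp) (by simp) ?_
    rintro _ ⟨τ, ⟨h0, h1⟩, rfl⟩
    refine hv.mul ?_
    rcases h1.lt_or_eq with h1 | rfl
    · refine (IsStrictlyPositive.add_nonneg ?_ (smul_nonneg h0 h.nonneg)).isUnit
      refine IsUnit.isStrictlyPositive ?_ (smul_nonneg (by linarith) zero_le_one)
      rw [← Algebra.algebraMap_eq_smul_one]
      exact (IsUnit.mk0 (1 - τ) (by linarith)).map (algebraMap ℝ E)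
    · simpa using h.isUnit

lemma Matrix.joinedIn_isUnit_submatrix_equiv {R m n : Type*} [Ring R] [TopologicalSpace R]
    [Fintype m] [DecidableEq m] [Fintype n] [DecidableEq n] (e : m ≃ n) {M : Matrix n n R}
    (h : JoinedIn {M : Matrix n n R | IsUnit M} 1 M) :
    JoinedIn {M : Matrix m m R | IsUnit M} 1 (M.submatrix e e) := by
  have h1 := h.map (f := fun M : Matrix n n R ↦ M.submatrix e e)
    (continuous_id.matrix_submatrix e e)
  rw [Matrix.submatrix_one_equiv] at h1
  refine h1.mono ?_
  rintro _ ⟨N, hN, rfl⟩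
  exact Matrix.isUnit_submatrix_equiv' e hN

lemma joinedIn_isUnit_of_fromBlocks_fin {R : Type*} [NormedRing R] [NormedAlgebra ℂ R]
    [CompleteSpace R] (hR : Dense {x : R | IsUnit x}) {ι : Type*} [Fintype ι] [DecidableEq ι]
    [Nonempty ι] (k : ℕ) : ∀ {V : Matrix ι ι R},
      JoinedIn {M : Matrix (ι ⊕ Fin k) (ι ⊕ Fin k) R | IsUnit M} 1 (Matrix.fromBlocks V 0 0 1) →
      JoinedIn {M : Matrix ι ι R | IsUnit M} 1 V := by
  induction k with
  | zero =>
    intro V h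
    have := Matrix.joinedIn_isUnit_submatrix_equiv (Equiv.sumEmpty ι (Fin 0)).symm h
    convert this using 1
    ext i j
    simp
  | succ k ih =>
    intro V h
    let f : Fin k ⊕ Unit ≃ Fin (k + 1) := Fintype.equivOfCardEq (by simp)
    have h1 := Matrix.joinedIn_isUnit_submatrix_equiv
      ((Equiv.sumAssoc ι (Fin k) Unit).trans ((Equiv.refl ι).sumCongr f)) h
    refine ih (joinedIn_isUnit_of_fromBlocks hR ?_)
    convert h1 using 1
    ext (i | i) (j | j) <;> [rcases i with i | i <;> rcases j with j | j; rcases i with i | i; rcases j with j | j; skip] <;>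
      simp [Matrix.one_apply]

lemma K1Trivial.joinedIn_isUnit {B : Type*} [NonUnitalCStarAlgebra B] (hB : K1Trivial B)
    (hs : StableRankOne B) {v : Unitization ℂ B} (hv : IsUnit v) :
    JoinedIn {x : Unitization ℂ B | IsUnit x} 1 v := by
  obtain ⟨U, -, hU, -, hj⟩ := CStarAlgebra.exists_unitary_retraction (Unitization ℂ B)
  refine JoinedIn.trans ?_ (hj v hv).symm
  have hu := hU v hv
  generalize U v = u at hu
  have hm : Matrix.diagonal (fun _ : Fin 1 ↦ u) ∈
      unitary (Matrix (Fin 1) (Fin 1) (Unitization ℂ B)) := by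
    constructor <;>
      simp [Matrix.star_eq_conjTranspose, Matrix.diagonal_conjTranspose, Matrix.diagonal_mul_diagonal,
        Unitary.star_mul_self_of_mem hu, Unitary.mul_star_self_of_mem hu]
  obtain ⟨k, h, hk⟩ := hB 1 one_pos ⟨_, hm⟩
  have h1 : JoinedIn {M : Matrix (Fin 1 ⊕ Fin k) (Fin 1 ⊕ Fin k) (Unitization ℂ B) | IsUnit M} 1
      (Matrix.fromBlocks (Matrix.diagonal (fun _ : Fin 1 ↦ u)) 0 0 1) := by
    obtain ⟨γ⟩ := hk
    exact ⟨γ.map continuous_subtype_val, fun t ↦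
      (Unitary.isUnit_coe (U := γ t) : _)⟩
  have h2 := (joinedIn_isUnit_of_fromBlocks_fin hs k h1).map
    (f := fun M : Matrix (Fin 1) (Fin 1) (Unitization ℂ B) ↦ M 0 0) (continuous_id.matrix_elem 0 0)
  simp only [Matrix.one_apply_eq, Matrix.diagonal_apply_eq] at h2
  refine h2.mono ?_
  rintro _ ⟨N, hN, rfl⟩
  obtain ⟨N', h1, h2⟩ := isUnit_iff_exists.mp hN
  exact isUnit_iff_exists.mpr ⟨N' 0 0,
    by simpa [Matrix.mul_apply] using congrArg (fun M : Matrix (Fin 1) (Fin 1) _ ↦ M 0 0) h1,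
    by simpa [Matrix.mul_apply] using congrArg (fun M : Matrix (Fin 1) (Fin 1) _ ↦ M 0 0) h2⟩

lemma IsUnit.one_add_mul_comm {R : Type*} [Ring R] {x y : R} (h : IsUnit (1 + x * y)) :
    IsUnit (1 + y * x) := by
  obtain ⟨w, h1, h2⟩ := isUnit_iff_exists.mp h
  have h1' : x * y * w = 1 - w := by rw [← h1]; noncomm_ring
  have h2' : w * (x * y) = 1 - w := by rw [← h2]; noncomm_ring
  refine isUnit_iff_exists.mpr ⟨1 - y * w * x, ?_, ?_⟩
  · have : (1 + y * x) * (1 - y * w * x) = 1 + y * x - y * w * x - y * (x * y * w) * x := by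
      noncomm_ring
    rw [this, h1']; noncomm_ring
  · have : (1 - y * w * x) * (1 + y * x) = 1 + y * x - y * w * x - y * (w * (x * y)) * x := by
      noncomm_ring
    rw [this, h2']; noncomm_ring

namespace Unitization

lemma eq_one_add_inr {A : Type*} [AddZeroClass A] {x : Unitization ℂ A} (hx : x.fst = 1) :
    x = 1 + (x.snd : Unitization ℂ A) := by
  ext <;> simp [hx]

section Ring

variable {A : Type*} [NonUnitalRing A] [Module ℂ A] [IsScalarTower ℂ A A] [SMulCommClass ℂ A A]

lemma isUnit_one_add_inr_iff {a : A} :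
    IsUnit (1 + (a : Unitization ℂ A)) ↔ ∃ z : A, a + z + a * z = 0 ∧ a + z + z * a = 0 := by
  constructor
  · intro h
    obtain ⟨w, h1, h2⟩ := isUnit_iff_exists.mp h
    have hw : w.fst = 1 := by simpa using congrArg (fun x : Unitization ℂ A ↦ x.fst) h1
    rw [eq_one_add_inr hw] at h1 h2
    refine ⟨w.snd, ?_, ?_⟩
    · have := congrArg (fun x : Unitization ℂ A ↦ x.snd) h1
      simp [mul_add, add_mul] at this
      rw [← this]; abel
    · have := congrArg (fun x : Unitization ℂ A ↦ x.snd) h2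
      simp [mul_add, add_mul] at this
      rw [← this]; abel
  · rintro ⟨z, h1, h2⟩
    have h1' := congrArg (inr (R := ℂ)) h1
    have h2' := congrArg (inr (R := ℂ)) h2
    simp only [inr_add, inr_mul, inr_zero] at h1' h2'
    refine isUnit_iff_exists.mpr ⟨1 + z, ?_, ?_⟩
    · calc (1 + (a : Unitization ℂ A)) * (1 + z) = 1 + (a + z + a * z) := by noncomm_ring
        _ = 1 := by rw [h1', add_zero]
    · calc (1 + (z : Unitization ℂ A)) * (1 + a) = 1 + (a + z + z * a) := by noncomm_ring
        _ = 1 := by rw [h2', add_zero]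

lemma fst_ne_zero_of_isUnit {x : Unitization ℂ A} (hx : IsUnit x) : x.fst ≠ 0 :=
  (hx.map (fstHom ℂ A)).ne_zero

/-- Invertibility in the unitization of a hereditary subalgebra. -/
lemma isUnit_of_isUnit_map {D : Type*} [NonUnitalRing D] [Module ℂ D] [IsScalarTower ℂ D D]
    [SMulCommClass ℂ D D] (φ : D →ₙₐ[ℂ] A) (hφ : Function.Injective φ)
    (hh : ∀ d a d', ∃ d'', φ d'' = φ d * a * φ d') {y : D}
    (hy : IsUnit (1 + (φ y : Unitization ℂ A))) : IsUnit (1 + (y : Unitization ℂ D)) := by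
  obtain ⟨z, h1, h2⟩ := isUnit_one_add_inr_iff.mp hy
  obtain ⟨d, hd⟩ := hh y z y
  obtain ⟨q, rfl⟩ : ∃ q, z = φ q := by
    refine ⟨-y + y * y + d, ?_⟩
    have e1 : z = - φ y - φ y * z := by
      rw [← sub_eq_zero, ← h1]; abel
    have e2 : z = - φ y - z * φ y := by
      rw [← sub_eq_zero, ← h2]; abel
    rw [map_add, map_add, map_neg, map_mul, hd]
    calc z = - φ y - φ y * z := e1
      _ = - φ y - φ y * (- φ y - z * φ y) := by rw [← e2]
      _ = _ := by noncomm_ring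
  refine isUnit_one_add_inr_iff.mpr ⟨q, hφ ?_, hφ ?_⟩
  · rw [map_zero, map_add, map_add, map_mul, h1]
  · rw [map_zero, map_add, map_add, map_mul, h2]

end Ring

end Unitization

lemma stableRankOne_iff {A : Type*} [NonUnitalCStarAlgebra A] :
    StableRankOne A ↔ Dense {a : A | IsUnit (1 + (a : Unitization ℂ A))} := by
  constructor
  · intro h a
    let ψ : Unitization ℂ A → A := fun x ↦ x.fst⁻¹ • x.snd
    have hc : ContinuousAt ψ (1 + (a : Unitization ℂ A)) :=
      (Unitization.continuous_fst.continuousAt.inv₀ (by simp)).smul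
        Unitization.continuous_snd.continuousAt
    have := hc.continuousWithinAt.mem_closure_image (h (1 + (a : Unitization ℂ A)))
    have ha : ψ (1 + (a : Unitization ℂ A)) = a := by simp [ψ]
    rw [ha] at this
    refine closure_mono ?_ this
    rintro _ ⟨x, hx, rfl⟩
    have h0 := Unitization.fst_ne_zero_of_isUnit hx
    have : 1 + (ψ x : Unitization ℂ A) = x.fst⁻¹ • x := by
      ext <;> simp [ψ, h0]
    change IsUnit (1 + (ψ x : Unitization ℂ A))
    rw [this, ← Units.val_mk0 (inv_ne_zero h0)]
    exact hx.smul (Units.mk0 _ (inv_ne_zero h0))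
  · intro h
    have h1 : ∀ x : Unitization ℂ A, x.fst ≠ 0 → x ∈ closure {x : Unitization ℂ A | IsUnit x} := by
      intro x hx
      have hc : Continuous fun a : A ↦ x.fst • (1 + (a : Unitization ℂ A)) := by
        have : Continuous fun a : A ↦ (a : Unitization ℂ A) := Unitization.continuous_inr
        fun_prop
      have := hc.continuousWithinAt.mem_closure_image (h (x.fst⁻¹ • x.snd))
      have hx' : x.fst • (1 + ((x.fst⁻¹ • x.snd : A) : Unitization ℂ A)) = x := by
        ext <;> simp [hx]
      simp only [hx'] at this
      refine closure_mono ?_ this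
      rintro _ ⟨a, ha, rfl⟩
      rw [← Units.val_mk0 hx]
      exact ha.smul (Units.mk0 _ hx)
    intro x
    by_cases hx : x.fst = 0
    · have hc : Continuous fun t : ℂ ↦ x + algebraMap ℂ (Unitization ℂ A) t := by fun_prop
      have h0 : (0 : ℂ) ∈ closure ({0}ᶜ : Set ℂ) := dense_compl_singleton 0 0
      have := hc.continuousWithinAt.mem_closure_image h0
      simp only [map_zero, add_zero] at this
      rw [← closure_closure]
      refine closure_mono ?_ this
      rintro _ ⟨t, ht, rfl⟩
      refine h1 _ ?_
      simpa [hx, Unitization.algebraMap_eq_inl] using ht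
    · exact h1 x hx

lemma exists_norm_mul_sub_lt {D : Type*} [NonUnitalCStarAlgebra D] (b : D) {ε : ℝ} (hε : 0 < ε) :
    ∃ e : D, ‖b * e - b‖ < ε := by
  let _ := CStarAlgebra.spectralOrder D
  have := CStarAlgebra.spectralOrderedRing D
  have h := CStarAlgebra.increasingApproximateUnit D
  have := h.neBot
  have h1 := Metric.tendsto_nhds.mp (h.tendsto_mul_left b) ε hε
  obtain ⟨e, he⟩ := h1.exists
  exact ⟨e, by rwa [dist_eq_norm] at he⟩

/-- Stable rank one passes to hereditary subalgebras. -/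
lemma StableRankOne.of_hereditary {D A : Type*} [NonUnitalCStarAlgebra D]
    [NonUnitalCStarAlgebra A] (φ : D →ₙₐ[ℂ] A) (hφ : ∀ d, ‖φ d‖ = ‖d‖)
    (hh : ∀ d a d', ∃ d'', φ d'' = φ d * a * φ d') (hA : StableRankOne A) : StableRankOne D := by
  have hinj : Function.Injective φ := by
    intro x y hxy
    rw [← sub_eq_zero, ← norm_eq_zero, ← hφ, map_sub, hxy, sub_self, norm_zero]
  rw [stableRankOne_iff] at hA ⊢
  rw [Metric.dense_iff]
  intro b ε hε
  obtain ⟨e, he⟩ := exists_norm_mul_sub_lt b (half_pos hε)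
  obtain ⟨κ, hκ0, hκ⟩ : ∃ κ > 0, ‖b‖ * κ * ‖e‖ < ε / 2 := by
    refine ⟨ε / 2 / (‖b‖ * ‖e‖ + 1), by positivity, ?_⟩
    rw [mul_right_comm, mul_div_assoc', div_lt_iff₀ (by positivity)]
    nlinarith
  have hcont : ContinuousAt (fun r : A ↦ Ring.inverse (1 + (r : Unitization ℂ A))) 0 := by
    have h1 : ContinuousAt Ring.inverse (1 + ((0 : A) : Unitization ℂ A)) := by
      simpa using NormedRing.inverse_continuousAt (1 : (Unitization ℂ A)ˣ)
    exact ContinuousAt.comp (f := fun r : A ↦ 1 + (r : Unitization ℂ A)) h1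
      (continuous_const.add Unitization.continuous_inr).continuousAt
  have hunit : ∀ᶠ r : A in nhds 0, IsUnit (1 + (r : Unitization ℂ A)) := by
    have hc : Continuous fun r : A ↦ 1 + (r : Unitization ℂ A) :=
      continuous_const.add Unitization.continuous_inr
    refine hc.continuousAt.eventually_mem (Units.isOpen.mem_nhds ?_)
    simp
  have hsmall : ∀ᶠ r : A in nhds 0, ‖(Ring.inverse (1 + (r : Unitization ℂ A))) - 1‖ < κ := by
    have := Metric.tendsto_nhds.mp hcont κ hκ0
    simpa [dist_eq_norm] using this
  obtain ⟨δ, hδ, hball⟩ := Metric.eventually_nhds_iff.mp (hunit.and hsmall)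
  obtain ⟨a', ha'1, ha'2⟩ := Metric.dense_iff.mp hA (φ (e * b)) δ hδ
  set r := a' - φ (e * b) with hr
  obtain ⟨hru, hrs⟩ := hball (y := r) (by simpa [hr, dist_eq_norm] using ha'1)
  set w := Ring.inverse (1 + (r : Unitization ℂ A)) with hw
  have hw1 : w * (1 + (r : Unitization ℂ A)) = 1 := Ring.inverse_mul_cancel _ hru
  have hwf : w.fst = 1 := by simpa using congrArg (fun x : Unitization ℂ A ↦ x.fst) hw1
  have hwe := Unitization.eq_one_add_inr hwf
  set s := w.snd
  have hs : ‖s‖ < κ := by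
    rw [hwe] at hrs
    simpa [Unitization.norm_inr] using hrs
  obtain ⟨d, hd⟩ := hh b s e
  have hunit1 : IsUnit (1 + w * (φ e : Unitization ℂ A) * (φ b : Unitization ℂ A)) := by
    have hwu : IsUnit w := hru.ringInverse
    have h3 := hwu.mul ha'2
    have : w * (1 + (a' : Unitization ℂ A)) =
        1 + w * (φ e : Unitization ℂ A) * (φ b : Unitization ℂ A) := by
      have : (a' : Unitization ℂ A) = r + φ e * φ b := by
        rw [← Unitization.inr_mul, ← Unitization.inr_add, hr, map_mul, sub_add_cancel]
      rw [this, ← add_assoc, mul_add, hw1, mul_assoc]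
    rwa [this] at h3
  have hunit2 := hunit1.one_add_mul_comm
  have heq : (φ b : Unitization ℂ A) * (w * (φ e : Unitization ℂ A)) =
      (φ (b * e + d) : Unitization ℂ A) := by
    rw [hwe, map_add, map_mul, hd]
    simp only [Unitization.inr_add, Unitization.inr_mul]
    noncomm_ring
  rw [heq] at hunit2
  refine ⟨b * e + d, ?_, Unitization.isUnit_of_isUnit_map φ hinj hh hunit2⟩
  rw [Metric.mem_ball, dist_eq_norm]
  have hdn : ‖d‖ ≤ ‖b‖ * κ * ‖e‖ := by
    rw [← hφ, hd]
    calc _ ≤ ‖φ b‖ * ‖s‖ * ‖φ e‖ := (norm_mul_le _ _).trans (by gcongr; exact norm_mul_le _ _)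
      _ ≤ _ := by rw [hφ, hφ]; gcongr
  calc ‖b * e + d - b‖ = ‖(b * e - b) + d‖ := by congr 1; abel
    _ ≤ ‖b * e - b‖ + ‖d‖ := norm_add_le _ _
    _ < ε := by linarith

/-- A continuous cutoff function: `1` on `(-∞, c]` and `0` on `[2c, ∞)`. -/
def cutoff (c x : ℝ) : ℝ := max 0 (min 1 (2 - x / c))

lemma continuous_cutoff (c : ℝ) : Continuous (cutoff c) := by
  unfold cutoff; fun_prop

lemma cutoff_nonneg (c x : ℝ) : 0 ≤ cutoff c x := le_max_left _ _

lemma cutoff_le_one (c x : ℝ) : cutoff c x ≤ 1 := max_le zero_le_one (min_le_left _ _)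

lemma cutoff_of_le {c x : ℝ} (hc : 0 < c) (h : x ≤ c) : cutoff c x = 1 := by
  have : x / c ≤ 1 := (div_le_one hc).mpr h
  rw [cutoff, min_eq_left (by linarith), max_eq_right zero_le_one]

lemma cutoff_of_ge {c x : ℝ} (hc : 0 < c) (h : 2 * c ≤ x) : cutoff c x = 0 := by
  have : 2 ≤ x / c := (le_div_iff₀ hc).mpr h
  rw [cutoff, max_eq_left]
  exact (min_le_right _ _).trans (by linarith)

lemma cutoff_mul_cutoff_two_mul {c : ℝ} (hc : 0 < c) (x : ℝ) :
    cutoff c x * cutoff (2 * c) x = cutoff c x := by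
  rcases le_total x (2 * c) with h | h
  · rw [cutoff_of_le (by positivity) h, mul_one]
  · rw [cutoff_of_ge hc h, zero_mul]

section

variable {E : Type*} [CStarAlgebra E]

/-- Elements cutting off an invertible element `α` at the bottom of the spectrum of `|α|²`. -/
lemma exists_cutoff_elements {α β : E} (hαβ : α * β = 1) (hβα : β * α = 1) {d : ℝ} (hd : 0 < d)
    (hd1 : 8 * d < 1) :
    ∃ k₁ k₂ k₃ : E, star k₃ = k₃ ∧ k₁ * k₂ = k₁ ∧ k₂ * k₁ = k₁ ∧ k₂ * k₃ = k₂ ∧ k₃ * k₁ = k₁ ∧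
      ‖k₂‖ ≤ 1 ∧ ‖α * k₃‖ ^ 2 ≤ 8 * d ∧ ‖α * k₁ * β‖ ≤ 1 ∧ ‖(1 - k₁) * β‖ ^ 2 ≤ 1 / d ∧
      (∀ t : ℝ, 0 < t → t ≤ 1 → IsUnit (1 - (1 - t) • k₃)) ∧
      ∃ m, k₃ = m * (star α * α - 1) := by
  let _ := CStarAlgebra.spectralOrder E
  have := CStarAlgebra.spectralOrderedRing E
  set h := star α * α with hh
  have hsa : IsSelfAdjoint h := IsSelfAdjoint.star_mul_self α
  have hunit : IsUnit h := by
    have hα : IsUnit α := isUnit_iff_exists.mpr ⟨β, hαβ, hβα⟩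
    exact hα.star.mul hα
  have hpos : ∀ x ∈ spectrum ℝ h, 0 < x := fun x hx ↦
    (hunit.isStrictlyPositive (star_mul_self_nonneg α)).spectrum_pos hx
  have hc : ∀ c, ContinuousOn (cutoff c) (spectrum ℝ h) := fun c ↦ (continuous_cutoff c).continuousOn
  have hcid : ContinuousOn (fun x : ℝ ↦ x) (spectrum ℝ h) := continuousOn_id
  have hcinv : ContinuousOn (fun x : ℝ ↦ x⁻¹) (spectrum ℝ h) :=
    continuousOn_inv₀.mono fun x hx ↦ (hpos x hx).ne'
  have hid : cfc (fun x : ℝ ↦ x) h = h := cfc_id' ℝ h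
  have hmul : ∀ c > 0, cfc (cutoff c) h * cfc (cutoff (2 * c)) h = cfc (cutoff c) h := by
    intro c hc0
    rw [← cfc_mul _ _ h (hc _) (hc _)]
    exact cfc_congr fun x _ ↦ cutoff_mul_cutoff_two_mul hc0 x
  have hmul' : ∀ c > 0, cfc (cutoff (2 * c)) h * cfc (cutoff c) h = cfc (cutoff c) h := by
    intro c hc0
    rw [(cfc_commute_cfc (cutoff (2 * c)) (cutoff c) h).eq, hmul c hc0]
  have hstar : ∀ f : ℝ → ℝ, star (cfc f h) = cfc f h := fun f ↦ (cfc_predicate f h).star_eq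
  have hβh : β * star β * h = 1 := by
    have : star β * star α = 1 := by rw [← star_mul, hαβ, star_one]
    rw [hh, mul_assoc, ← mul_assoc (star β), this, one_mul, hβα]
  have hinv : cfc (fun x : ℝ ↦ x⁻¹) h = β * star β := by
    have h1 : h * cfc (fun x : ℝ ↦ x⁻¹) h = 1 := by
      calc h * cfc (fun x : ℝ ↦ x⁻¹) h = cfc (fun x : ℝ ↦ x * x⁻¹) h := by
            rw [cfc_mul _ _ h hcid hcinv, hid]
        _ = cfc (fun _ : ℝ ↦ (1 : ℝ)) h := cfc_congr fun x hx ↦ mul_inv_cancel₀ (hpos x hx).ne'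
        _ = 1 := cfc_const_one ℝ h
    rw [← one_mul (cfc _ _), ← hβh, mul_assoc, h1, mul_one]
  refine ⟨cfc (cutoff d) h, cfc (cutoff (2 * d)) h, cfc (cutoff (2 * (2 * d))) h, hstar _,
    hmul d hd, hmul' d hd, hmul _ (by positivity), ?_, ?_, ?_, ?_, ?_, ?_, ?_⟩
  · rw [← hmul' d hd, ← mul_assoc, hmul' _ (by positivity)]
  · refine norm_cfc_le zero_le_one fun x _ ↦ ?_
    rw [Real.norm_of_nonneg (cutoff_nonneg _ _)]
    exact cutoff_le_one _ _
  · have : star (α * cfc (cutoff (2 * (2 * d))) h) * (α * cfc (cutoff (2 * (2 * d))) h) =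
        cfc (fun x ↦ cutoff (2 * (2 * d)) x * x * cutoff (2 * (2 * d)) x) h := by
      rw [cfc_mul _ _ h ((hc _).fun_mul hcid) (hc _), cfc_mul _ _ h (hc _) hcid, hid, star_mul,
        hstar]
      simp only [hh, mul_assoc]
    rw [sq, ← CStarRing.norm_star_mul_self, this]
    refine norm_cfc_le (by positivity) fun x hx ↦ ?_
    have hx0 := hpos x hx
    rw [Real.norm_of_nonneg (by have := cutoff_nonneg (2 * (2 * d)) x; positivity)]
    rcases le_total x (8 * d) with h1 | h1
    · have h2 := cutoff_nonneg (2 * (2 * d)) x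
      have h3 := cutoff_le_one (2 * (2 * d)) x
      calc _ ≤ 1 * x * 1 := by gcongr
        _ ≤ 8 * d := by linarith
    · rw [cutoff_of_ge (by positivity) (by linarith)]
      simp [hd.le]
  · have hcs : ContinuousOn (fun x ↦ √(cutoff d x * x⁻¹)) (spectrum ℝ h) :=
      ((hc _).mul hcinv).sqrt
    set q := cfc (fun x ↦ √(cutoff d x * x⁻¹)) h with hq
    have hnn : ∀ x ∈ spectrum ℝ h, 0 ≤ cutoff d x * x⁻¹ := fun x hx ↦
      mul_nonneg (cutoff_nonneg _ _) (inv_nonneg.mpr (hpos x hx).le)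
    have hqq : q * q * h = cfc (cutoff d) h := by
      have : q * q * h = cfc (fun x ↦ √(cutoff d x * x⁻¹) * √(cutoff d x * x⁻¹) * x) h := by
        rw [cfc_mul _ _ h (hcs.fun_mul hcs) hcid, cfc_mul _ _ h hcs hcs, hid]
      rw [this]
      refine cfc_congr fun x hx ↦ ?_
      rw [Real.mul_self_sqrt (hnn x hx), mul_assoc, inv_mul_cancel₀ (hpos x hx).ne', mul_one]
    have hqhq : q * h * q = cfc (cutoff d) h := by
      have := (cfc_commute_cfc (fun x : ℝ ↦ x) (fun x ↦ √(cutoff d x * x⁻¹)) h).eq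
      rw [hid] at this
      rw [← hqq, mul_assoc, this, mul_assoc]
    have : α * cfc (cutoff d) h * β = (α * q) * star (α * q) := by
      rw [star_mul, hstar, ← hqq, hh]
      calc α * (q * q * (star α * α)) * β = α * q * (q * star α) * (α * β) := by
            simp only [mul_assoc]
        _ = _ := by rw [hαβ, mul_one]
    rw [this, CStarRing.norm_self_mul_star, ← CStarRing.norm_star_mul_self, star_mul, hstar]
    have h2 : q * star α * (α * q) = cfc (cutoff d) h := by
      rw [← hqhq, hh]; simp only [mul_assoc]
    rw [h2]
    refine norm_cfc_le zero_le_one fun x _ ↦ ?_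
    rw [Real.norm_of_nonneg (cutoff_nonneg _ _)]
    exact cutoff_le_one _ _
  · have h1 : 1 - cfc (cutoff d) h = cfc (fun x ↦ 1 - cutoff d x) h := by
      rw [cfc_sub _ _ h continuousOn_const (hc _), cfc_const_one ℝ h]
    have hc1 : ContinuousOn (fun x ↦ 1 - cutoff d x) (spectrum ℝ h) := continuousOn_const.sub (hc _)
    rw [h1, sq, ← CStarRing.norm_self_mul_star, star_mul, hstar]
    have h2 : cfc (fun x ↦ 1 - cutoff d x) h * β * (star β * cfc (fun x ↦ 1 - cutoff d x) h) =
        cfc (fun x ↦ (1 - cutoff d x) * x⁻¹ * (1 - cutoff d x)) h := by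
      rw [cfc_mul _ _ h (hc1.fun_mul hcinv) hc1, cfc_mul _ _ h hc1 hcinv, hinv]
      simp only [mul_assoc]
    rw [h2]
    refine norm_cfc_le (by positivity) fun x hx ↦ ?_
    have hx0 := hpos x hx
    have h3 := cutoff_nonneg d x
    have h4 : 0 ≤ 1 - cutoff d x := sub_nonneg.mpr (cutoff_le_one d x)
    rw [Real.norm_of_nonneg (by positivity)]
    rcases le_total x d with h5 | h5
    · rw [cutoff_of_le hd h5]
      simp [hd.le]
    · calc _ ≤ 1 * d⁻¹ * 1 := by gcongr <;> linarith
        _ = 1 / d := by rw [one_mul, mul_one, one_div]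
  · intro t ht0 ht1
    have h1 : 1 - (1 - t) • cfc (cutoff (2 * (2 * d))) h =
        cfc (fun x ↦ 1 - (1 - t) • cutoff (2 * (2 * d)) x) h := by
      rw [cfc_sub _ _ h continuousOn_const ((hc _).fun_const_smul (1 - t)), cfc_const_one ℝ h,
        cfc_smul _ _ h (hc _)]
    rw [h1, isUnit_cfc_iff _ h (continuousOn_const.fun_sub ((hc _).fun_const_smul (1 - t)))]
    intro x _
    have h2 := cutoff_nonneg (2 * (2 * d)) x
    have h3 := cutoff_le_one (2 * (2 * d)) x
    simp only [smul_eq_mul]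
    nlinarith
  · have hne : ∀ x : ℝ, min x (8 * d) - 1 ≠ 0 := fun x ↦ by
      have := min_le_right x (8 * d)
      linarith
    have hcm : ContinuousOn (fun x ↦ cutoff (2 * (2 * d)) x / (min x (8 * d) - 1))
        (spectrum ℝ h) := by
      refine ((continuous_cutoff _).div (by fun_prop) hne).continuousOn
    refine ⟨cfc (fun x ↦ cutoff (2 * (2 * d)) x / (min x (8 * d) - 1)) h, ?_⟩
    have h1 : h - 1 = cfc (fun x : ℝ ↦ x - 1) h := by
      rw [cfc_sub _ _ h hcid continuousOn_const, cfc_const_one ℝ h, cfc_id' ℝ h]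
    rw [h1, ← cfc_mul _ _ h hcm (by fun_prop)]
    refine cfc_congr fun x _ ↦ ?_
    rcases le_total x (8 * d) with h2 | h2
    · have := hne x
      rw [min_eq_left h2] at this
      simp only [min_eq_left h2]
      rw [div_mul_cancel₀ _ this]
    · simp [cutoff_of_ge (c := 2 * (2 * d)) (x := x) (by positivity) (by linarith)]

end

lemma Unitization.fst_sub' {A : Type*} [AddGroup A] (x y : Unitization ℂ A) :
    (x - y).fst = x.fst - y.fst := rfl

lemma NonUnitalStarSubalgebra.exists_coe_eq {A : Type*} [NonUnitalCStarAlgebra A]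
    {B : NonUnitalStarSubalgebra ℂ A} (hB : ∀ b ∈ B, ∀ a : A, ∀ b' ∈ B, b * a * b' ∈ B)
    (d : B) (a : A) (d' : B) : ∃ d'' : B, (d'' : A) = d * a * d' :=
  ⟨⟨d * a * d', hB _ d.2 a _ d'.2⟩, rfl⟩

lemma NoK1Obstructions.joinedIn_hereditary {A : Type*} [NonUnitalCStarAlgebra A]
    (hA : NoK1Obstructions A) {B : NonUnitalStarSubalgebra ℂ A} [IsClosed (B : Set A)]
    (hB : ∀ b ∈ B, ∀ a : A, ∀ b' ∈ B, b * a * b' ∈ B) {b : A} (hb : b ∈ B)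
    (hu : IsUnit (1 + (b : Unitization ℂ A))) :
    JoinedIn {c : A | c ∈ B ∧ IsUnit (1 + (c : Unitization ℂ A))} 0 b := by
  let φ : B →ₙₐ[ℂ] A := NonUnitalSubalgebraClass.subtype B
  have hh : ∀ (d : B) (a : A) (d' : B), ∃ d'', φ d'' = φ d * a * φ d' :=
    NonUnitalStarSubalgebra.exists_coe_eq hB
  have hBs : StableRankOne B := hA.1.of_hereditary φ (fun _ ↦ rfl) hh
  have hu' : IsUnit (1 + ((⟨b, hb⟩ : B) : Unitization ℂ B)) :=
    Unitization.isUnit_of_isUnit_map φ Subtype.val_injective hh hu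
  have hj := (hA.2 B hB).joinedIn_isUnit hBs hu'
  have hj' := hj.map_continuousOn (f := fun x : Unitization ℂ B ↦ x.fst⁻¹ • (x.snd : A)) (by
    intro x hx
    exact ((Unitization.continuous_fst.continuousAt.inv₀
      (Unitization.fst_ne_zero_of_isUnit hx)).smul
      (continuous_subtype_val.comp Unitization.continuous_snd).continuousAt).continuousWithinAt)
  simp only [Unitization.fst_one, inv_one, Unitization.snd_one, ZeroMemClass.coe_zero, smul_zero,
    Unitization.fst_add, Unitization.fst_inr, add_zero, Unitization.snd_add, Unitization.snd_inr,
    zero_add, one_smul] at hj'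
  refine hj'.mono ?_
  rintro _ ⟨x, hx, rfl⟩
  refine ⟨SMulMemClass.smul_mem _ x.snd.2, ?_⟩
  have h0 := Unitization.fst_ne_zero_of_isUnit hx
  have h1 : IsUnit (1 + ((x.fst⁻¹ • x.snd : B) : Unitization ℂ B)) := by
    have : 1 + ((x.fst⁻¹ • x.snd : B) : Unitization ℂ B) = x.fst⁻¹ • x := by
      ext <;> simp [h0]
    rw [this, ← Units.val_mk0 (inv_ne_zero h0)]
    exact hx.smul (Units.mk0 _ (inv_ne_zero h0))
  obtain ⟨z, hz1, hz2⟩ := Unitization.isUnit_one_add_inr_iff.mp h1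
  exact Unitization.isUnit_one_add_inr_iff.mpr ⟨z, congrArg Subtype.val hz1,
    congrArg Subtype.val hz2⟩

/-- The hereditary subalgebra of elements on which `κ` acts as a unit. -/
def NonUnitalStarSubalgebra.fixedBy {A : Type*} [NonUnitalCStarAlgebra A] (κ : A)
    (hκ : star κ = κ) : NonUnitalStarSubalgebra ℂ A where
  carrier := {b | κ * b = b ∧ b * κ = b}
  add_mem' := by
    rintro a b ⟨h1, h2⟩ ⟨h3, h4⟩
    exact ⟨by rw [mul_add, h1, h3], by rw [add_mul, h2, h4]⟩
  zero_mem' := by simp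
  mul_mem' := by
    rintro a b ⟨h1, h2⟩ ⟨h3, h4⟩
    exact ⟨by rw [← mul_assoc, h1], by rw [mul_assoc, h4]⟩
  smul_mem' := by
    rintro c a ⟨h1, h2⟩
    exact ⟨by rw [mul_smul_comm, h1], by rw [smul_mul_assoc, h2]⟩
  star_mem' := by
    rintro a ⟨h1, h2⟩
    have h1' := congrArg star h1
    have h2' := congrArg star h2
    rw [star_mul, hκ] at h1' h2'
    exact ⟨h2', h1'⟩

lemma NonUnitalStarSubalgebra.isClosed_fixedBy {A : Type*} [NonUnitalCStarAlgebra A] (κ : A)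
    (hκ : star κ = κ) : IsClosed (fixedBy κ hκ : Set A) :=
  (isClosed_eq (by fun_prop) continuous_id).inter (isClosed_eq (by fun_prop) continuous_id)

/-- Close invertible elements of an algebra without `K₁`-obstructions are joined by a path of
invertible elements that stays close, uniformly in the end points. -/
lemma NoK1Obstructions.exists_joinedIn {A : Type*} [NonUnitalCStarAlgebra A]
    (hA : NoK1Obstructions A) {η : ℝ} (hη : 0 < η) :
    ∃ ε > 0, ∀ a a' : A, IsUnit (1 + (a : Unitization ℂ A)) →
      IsUnit (1 + (a' : Unitization ℂ A)) → ‖a' - a‖ < ε →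
      JoinedIn {c : A | IsUnit (1 + (c : Unitization ℂ A)) ∧ ‖c - a‖ < η} a a' := by
  obtain ⟨d, hd, hd1, hd2⟩ : ∃ d : ℝ, 0 < d ∧ 8 * d < 1 ∧ 8 * d < (η / 4) ^ 2 := by
    have : 0 < min 1 ((η / 4) ^ 2) := by positivity
    refine ⟨min 1 ((η / 4) ^ 2) / 16, by positivity, ?_, ?_⟩
    · have := min_le_left 1 ((η / 4) ^ 2); linarith
    · have := min_le_right 1 ((η / 4) ^ 2); linarith
  obtain ⟨K, hK, hKd⟩ : ∃ K : ℝ, 1 ≤ K ∧ 1 / d ≤ K ^ 2 := by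
    have : 1 ≤ 1 / d := by rw [le_div_iff₀ hd]; linarith
    exact ⟨1 / d, this, by nlinarith⟩
  refine ⟨min (η / 16) (1 / 2 / K), by positivity, fun a a' ha ha' haa ↦ ?_⟩
  have haa1 : ‖a' - a‖ < η / 16 := haa.trans_le (min_le_left _ _)
  have haa2 : K * ‖a' - a‖ ≤ 1 / 2 := by
    have := (haa.trans_le (min_le_right _ _)).le
    rwa [le_div_iff₀' (by linarith)] at this
  clear haa
  set α : Unitization ℂ A := 1 + a with hα
  set α' : Unitization ℂ A := 1 + a' with hα'
  obtain ⟨β, hαβ, hβα⟩ := isUnit_iff_exists.mp ha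
  obtain ⟨k₁, k₂, k₃, hk₃, h12, h21, h23, h31, hk₂, hαk, hαkβ, hg, hE, m, hm⟩ :=
    exists_cutoff_elements hαβ hβα hd hd1
  have hfα : α.fst = 1 := by simp [hα]
  have hf3 : k₃.fst = 0 := by rw [hm]; simp [hfα, Unitization.fst_sub']
  have hf1 : k₁.fst = 0 := by rw [← h31]; simp [hf3]
  have hf2 : k₂.fst = 0 := by rw [← h23]; simp [hf3]
  -- it suffices to find a path in the unitization
  suffices hS : JoinedIn {x : Unitization ℂ A | IsUnit x ∧ x.fst = 1 ∧ ‖x - α‖ < η} α α' by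
    have h1 := hS.map (f := fun x : Unitization ℂ A ↦ x.snd) Unitization.continuous_snd
    simp only [hα, hα', Unitization.snd_add, Unitization.snd_one, Unitization.snd_inr, zero_add]
      at h1
    refine h1.mono ?_
    rintro _ ⟨x, ⟨hx, hx1, hx2⟩, rfl⟩
    have h2 := Unitization.eq_one_add_inr hx1
    refine ⟨h2 ▸ hx, ?_⟩
    rw [h2, add_sub_add_left_eq_sub, ← Unitization.inr_sub, Unitization.norm_inr] at hx2
    exact hx2
  set r : Unitization ℂ A := α' - α with hr
  have hrn : ‖r‖ = ‖a' - a‖ := by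
    rw [hr, hα, hα', add_sub_add_left_eq_sub, ← Unitization.inr_sub, Unitization.norm_inr]
  have hfr : r.fst = 0 := by simp [hr, hα, hα', Unitization.fst_sub']
  set g := (1 - k₁) * β with hgdef
  have hgn : ‖g‖ ≤ K := by
    exact abs_le_of_sq_le_sq' (hg.trans hKd) (by linarith) |>.2
  have hgr : ‖g * r‖ ≤ 1 / 2 := by
    calc _ ≤ ‖g‖ * ‖r‖ := norm_mul_le _ _
      _ ≤ K * ‖a' - a‖ := by rw [hrn]; gcongr
      _ ≤ _ := haa2
  have hunit : ∀ τ : ℝ, 0 ≤ τ → τ ≤ 1 → IsUnit (1 + τ • (g * r)) := by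
    intro τ h0 h1
    have : ‖-(τ • (g * r))‖ < 1 := by
      rw [norm_neg, norm_smul, Real.norm_of_nonneg h0]
      nlinarith [norm_nonneg (g * r)]
    simpa using (Units.oneSub _ this).isUnit
  obtain ⟨w, hw1, hw2⟩ := isUnit_iff_exists.mp (by simpa using hunit 1 zero_le_one le_rfl)
  have hwn : ‖w‖ ≤ 2 := by
    have : w = 1 - g * r * w := by rw [← hw1]; noncomm_ring
    have h1 : ‖w‖ ≤ 1 + 1 / 2 * ‖w‖ := by
      calc ‖w‖ = ‖1 - g * r * w‖ := by rw [← this]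
        _ ≤ ‖(1 : Unitization ℂ A)‖ + ‖g * r * w‖ := norm_sub_le _ _
        _ ≤ 1 + ‖g * r‖ * ‖w‖ := by rw [norm_one]; gcongr; exact norm_mul_le _ _
        _ ≤ _ := by gcongr
    linarith
  set s := β * r * w with hs
  set p := α * k₁ * s with hp
  have hpn : ‖p‖ ≤ η / 8 := by
    have : p = α * k₁ * β * (r * w) := by rw [hp, hs]; simp only [mul_assoc]
    calc ‖p‖ ≤ ‖α * k₁ * β‖ * (‖r‖ * ‖w‖) := by
          rw [this]
          exact (norm_mul_le _ _).trans (by gcongr; exact norm_mul_le _ _)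
      _ ≤ 1 * (η / 16 * 2) := by rw [hrn]; gcongr
      _ = η / 8 := by ring
  have hfac : (1 + k₁ * s) * (1 + g * r) = β * α' := by
    have h1 : s * (1 + g * r) = β * r := by rw [hs, mul_assoc, hw2, mul_one]
    calc (1 + k₁ * s) * (1 + g * r) = 1 + (1 - k₁) * β * r + k₁ * (s * (1 + g * r)) := by
          rw [hgdef]; noncomm_ring
      _ = 1 + β * r := by rw [h1]; noncomm_ring
      _ = β * α' := by rw [hr, mul_sub, hβα]; abel
  have hk1s : IsUnit (1 + k₁ * s) := by
    have hβ : IsUnit β := isUnit_iff_exists.mpr ⟨α, hβα, hαβ⟩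
    have hw : IsUnit w := isUnit_iff_exists.mpr ⟨_, hw2, hw1⟩
    have := (hβ.mul ha').mul hw
    rwa [← hfac, mul_assoc, hw1, mul_one] at this
  set b := k₁ * s * k₂ with hb
  have hv : IsUnit (1 + b) := by
    have h1 : IsUnit (1 + k₂ * (k₁ * s)) := by rwa [← mul_assoc, h21]
    exact h1.one_add_mul_comm
  have hfb : b.fst = 0 := by simp [hb, hf1]
  have hbA : b = ((b.snd : A) : Unitization ℂ A) := by ext <;> simp [hfb]
  have hk3A : k₃ = ((k₃.snd : A) : Unitization ℂ A) := by ext <;> simp [hf3]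
  have hκ : star k₃.snd = k₃.snd := congrArg (fun x : Unitization ℂ A ↦ x.snd) hk₃
  let B := NonUnitalStarSubalgebra.fixedBy k₃.snd hκ
  have : IsClosed (B : Set A) := NonUnitalStarSubalgebra.isClosed_fixedBy _ _
  have hBh : ∀ b ∈ B, ∀ a : A, ∀ b' ∈ B, b * a * b' ∈ B := by
    rintro b ⟨h1, -⟩ a b' ⟨-, h2⟩
    exact ⟨by rw [← mul_assoc, ← mul_assoc, h1], by rw [mul_assoc, h2]⟩
  have hbB : b.snd ∈ B := by
    have h1 : k₃ * b = b := by rw [hb, ← mul_assoc, ← mul_assoc, h31]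
    have h2 : b * k₃ = b := by rw [hb, mul_assoc, h23]
    rw [hbA, hk3A, ← Unitization.inr_mul] at h1 h2
    exact ⟨Unitization.inr_injective h1, Unitization.inr_injective h2⟩
  obtain ⟨γ, hγ⟩ := hA.joinedIn_hereditary hBh hbB (hbA ▸ hv)
  obtain ⟨C, hC⟩ := (isCompact_range γ.continuous).isBounded.exists_norm_le
  have hC0 : 0 ≤ C := (norm_nonneg _).trans (hC (γ 0) ⟨0, rfl⟩)
  have hαk3 : ‖α * k₃‖ ≤ η / 4 := abs_le_of_sq_le_sq' (hαk.trans hd2.le) (by positivity) |>.2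
  obtain ⟨t₀, ht0, ht1, htC⟩ : ∃ t₀ : ℝ, 0 < t₀ ∧ t₀ ≤ 1 ∧ t₀ * (‖α‖ * C) ≤ η / 4 := by
    have hpos : 0 < ‖α‖ * C + 1 := by positivity
    refine ⟨min 1 (η / 4 / (‖α‖ * C + 1)), by positivity, min_le_left _ _, ?_⟩
    calc _ ≤ η / 4 / (‖α‖ * C + 1) * (‖α‖ * C + 1) := by gcongr; exacts [min_le_right _ _, by linarith]
      _ = η / 4 := div_mul_cancel₀ _ hpos.ne'
  have hEb : ∀ t : ℝ, ∀ c ∈ B, (1 - (1 - t) • k₃) * (1 + (c : Unitization ℂ A)) =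
      1 - (1 - t) • k₃ + t • (c : Unitization ℂ A) := by
    intro t c hc
    have : k₃ * (c : Unitization ℂ A) = c := by
      rw [hk3A, ← Unitization.inr_mul, hc.1]
    rw [mul_add, mul_one, sub_mul, one_mul, smul_mul_assoc, this, sub_smul 1 t (c : Unitization ℂ A),
      one_smul, sub_sub_cancel]
  have hEn : ∀ t : ℝ, 0 < t → t ≤ 1 → ∀ c ∈ B, IsUnit (1 + (c : Unitization ℂ A)) →
      ‖t • (α * (c : Unitization ℂ A))‖ ≤ η / 4 →
      α * ((1 - (1 - t) • k₃) * (1 + (c : Unitization ℂ A))) ∈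
        {x : Unitization ℂ A | IsUnit x ∧ x.fst = 1 ∧ ‖x - α‖ < η} := by
    intro t h0 h1 c hc hcu hcn
    refine ⟨ha.mul ((hE t h0 h1).mul hcu), by simp [hfα, hf3, Unitization.fst_sub'], ?_⟩
    have : α * ((1 - (1 - t) • k₃) * (1 + (c : Unitization ℂ A))) - α =
        t • (α * (c : Unitization ℂ A)) - (1 - t) • (α * k₃) := by
      rw [hEb t c hc, mul_add, mul_sub, mul_one, mul_smul_comm, mul_smul_comm]
      abel
    rw [this]
    calc _ ≤ _ := norm_sub_le _ _
      _ ≤ η / 4 + 1 * (η / 4) := by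
        rw [norm_smul (1 - t), Real.norm_of_nonneg (by linarith)]
        gcongr
        linarith
      _ < η := by linarith
  have hαb : α * b = p * k₂ := by rw [hb, hp]; simp only [mul_assoc]
  have hpk : ‖p * k₂‖ ≤ η / 8 := (norm_mul_le _ _).trans <| by
    calc _ ≤ η / 8 * 1 := by gcongr
      _ = _ := mul_one _
  have hfp : p.fst = 0 := by simp [hp, hf1]
  have hline : ∀ c ∈ B, IsUnit (1 + (c : Unitization ℂ A)) → (∀ t : ℝ, t₀ ≤ t → t ≤ 1 →
      ‖t • (α * (c : Unitization ℂ A))‖ ≤ η / 4) →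
      JoinedIn {x : Unitization ℂ A | IsUnit x ∧ x.fst = 1 ∧ ‖x - α‖ < η}
        (α * ((1 - (1 - t₀) • k₃) * (1 + (c : Unitization ℂ A))))
        (α * (1 + (c : Unitization ℂ A))) := by
    intro c hc hcu hcn
    refine JoinedIn.ofLine (f := fun τ : ℝ ↦
      α * ((1 - (1 - (t₀ + τ * (1 - t₀))) • k₃) * (1 + (c : Unitization ℂ A)))) (by fun_prop)
      (by simp) (by simp) ?_
    rintro _ ⟨τ, ⟨h0, h1⟩, rfl⟩
    have h2 : t₀ ≤ t₀ + τ * (1 - t₀) := by nlinarith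
    have h3 : t₀ + τ * (1 - t₀) ≤ 1 := by nlinarith
    exact hEn _ (by linarith) h3 c hc hcu (hcn _ h2 h3)
  have hj1 := (hline 0 B.zero_mem (by simp) (by intro t _ _; simp; positivity)).symm
  have hj2 : JoinedIn {x : Unitization ℂ A | IsUnit x ∧ x.fst = 1 ∧ ‖x - α‖ < η}
      (α * ((1 - (1 - t₀) • k₃) * (1 + ((0 : A) : Unitization ℂ A))))
      (α * ((1 - (1 - t₀) • k₃) * (1 + b))) := by
    rw [hbA]
    have hc : Continuous fun c : A ↦ α * ((1 - (1 - t₀) • k₃) * (1 + (c : Unitization ℂ A))) := by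
      have : Continuous fun a : A ↦ (a : Unitization ℂ A) := Unitization.continuous_inr
      fun_prop
    refine ⟨(γ.map hc), fun t ↦ ?_⟩
    refine hEn t₀ ht0 ht1 (γ t) (hγ t).1 (hγ t).2 ?_
    rw [norm_smul, Real.norm_of_nonneg ht0.le]
    refine le_trans ?_ htC
    gcongr
    refine (norm_mul_le _ _).trans ?_
    rw [Unitization.norm_inr]
    gcongr
    exact hC _ ⟨t, rfl⟩
  have hj3 : JoinedIn {x : Unitization ℂ A | IsUnit x ∧ x.fst = 1 ∧ ‖x - α‖ < η}
      (α * ((1 - (1 - t₀) • k₃) * (1 + b))) (α * (1 + b)) := by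
    rw [hbA]
    refine hline b.snd hbB (hbA ▸ hv) fun t h0 h1 ↦ ?_
    rw [← hbA, hαb, norm_smul, Real.norm_of_nonneg (by linarith)]
    calc _ ≤ 1 * (η / 8) := by gcongr
      _ ≤ _ := by linarith
  obtain ⟨v', hv1, hv2⟩ := isUnit_iff_exists.mp hv
  have hj4 : JoinedIn {x : Unitization ℂ A | IsUnit x ∧ x.fst = 1 ∧ ‖x - α‖ < η}
      (α * (1 + b)) (α * (1 + k₁ * s)) := by
    refine JoinedIn.ofLine (f := fun τ : ℝ ↦ α * (1 + b) + τ • (p * (1 - k₂))) (by fun_prop)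
      (by simp) (by simp only [one_smul]; rw [hb, hp]; noncomm_ring) ?_
    rintro _ ⟨τ, ⟨h0, h1⟩, rfl⟩
    refine ⟨?_, by simp [hfα, hfb, hfp, Unitization.fst_sub'], ?_⟩
    · have hyv : (1 - k₂) * v' = 1 - k₂ := by
        have h2 : (1 - k₂) * (1 + b) = 1 - k₂ := by
          have : k₂ * b = b := by rw [hb, ← mul_assoc, ← mul_assoc, h21]
          rw [mul_add, mul_one, sub_mul, one_mul, this, sub_self, add_zero]
        rw [← h2, mul_assoc, hv1, mul_one, h2]
      set y := v' * (k₁ * s) * (1 - k₂) with hy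
      have hyy : y * y = 0 := by
        have h3 : (1 - k₂) * k₁ = 0 := by rw [sub_mul, one_mul, h21, sub_self]
        have : y * y = v' * (k₁ * s) * (((1 - k₂) * v') * k₁) * s * (1 - k₂) := by
          rw [hy]; simp only [mul_assoc]
        rw [this, hyv, h3]; simp
      have hyu : IsUnit (1 + τ • y) := by
        refine isUnit_iff_exists.mpr ⟨1 - τ • y, ?_, ?_⟩
        · have : (1 + τ • y) * (1 - τ • y) = 1 - (τ • y) * (τ • y) := by
            generalize τ • y = z
            noncomm_ring
          rw [this, smul_mul_smul_comm, hyy]; simp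
        · have : (1 - τ • y) * (1 + τ • y) = 1 - (τ • y) * (τ • y) := by
            generalize τ • y = z
            noncomm_ring
          rw [this, smul_mul_smul_comm, hyy]; simp
      have : α * (1 + b) + τ • (p * (1 - k₂)) = α * ((1 + b) * (1 + τ • y)) := by
        have h4 : (1 + b) * y = k₁ * s * (1 - k₂) := by
          rw [hy, ← mul_assoc, ← mul_assoc, hv1, one_mul]
        rw [mul_add (1 + b), mul_one, mul_smul_comm, h4, mul_add α (1 + b), mul_smul_comm, hp]
        simp only [mul_assoc]
      change IsUnit (α * (1 + b) + τ • (p * (1 - k₂)))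
      rw [this]
      exact ha.mul (hv.mul hyu)
    · have : α * (1 + b) + τ • (p * (1 - k₂)) - α = p * k₂ + τ • (p - p * k₂) := by
        rw [mul_add, mul_one, hαb, mul_sub, mul_one]; abel
      change ‖α * (1 + b) + τ • (p * (1 - k₂)) - α‖ < η
      rw [this]
      calc _ ≤ ‖p * k₂‖ + ‖τ • (p - p * k₂)‖ := norm_add_le _ _
        _ ≤ η / 8 + 1 * (η / 8 + η / 8) := by
          rw [norm_smul, Real.norm_of_nonneg h0]
          gcongr
          exact (norm_sub_le _ _).trans (by gcongr)
        _ < η := by linarith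
  have hj5 : JoinedIn {x : Unitization ℂ A | IsUnit x ∧ x.fst = 1 ∧ ‖x - α‖ < η}
      (α * (1 + k₁ * s)) α' := by
    refine JoinedIn.ofLine (f := fun τ : ℝ ↦ α * ((1 + k₁ * s) * (1 + τ • (g * r)))) (by fun_prop)
      (by simp) (by simp only [one_smul]; rw [hfac, ← mul_assoc, hαβ, one_mul]) ?_
    rintro _ ⟨τ, ⟨h0, h1⟩, rfl⟩
    refine ⟨ha.mul (hk1s.mul (hunit τ h0 h1)), by simp [hfα, hf1, hfr], ?_⟩
    have : α * ((1 + k₁ * s) * (1 + τ • (g * r))) - α =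
        p + τ • ((1 - α * k₁ * β) * r + p * (g * r)) := by
      have h5 : (1 - α * k₁ * β) * r = α * (g * r) := by
        calc (1 - α * k₁ * β) * r = 1 * r - α * k₁ * β * r := sub_mul _ _ _
          _ = α * β * r - α * k₁ * β * r := by rw [hαβ]
          _ = α * (g * r) := by rw [hgdef]; noncomm_ring
      rw [h5, hp, ← mul_smul_comm]
      noncomm_ring
    change ‖α * ((1 + k₁ * s) * (1 + τ • (g * r))) - α‖ < η
    rw [this]
    calc _ ≤ ‖p‖ + τ * ‖(1 - α * k₁ * β) * r + p * (g * r)‖ := by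
          refine (norm_add_le _ _).trans ?_
          rw [norm_smul, Real.norm_of_nonneg h0]
      _ ≤ η / 8 + 1 * ((1 + 1) * (η / 16) + η / 8 * (1 / 2)) := by
          gcongr
          refine (norm_add_le _ _).trans ?_
          gcongr
          · refine (norm_mul_le _ _).trans ?_
            rw [hrn]
            gcongr
            refine (norm_sub_le _ _).trans ?_
            rw [norm_one]
            gcongr
          · exact (norm_mul_le _ _).trans (by gcongr)
      _ < η := by linarith
  have h0 : α * (1 + ((0 : A) : Unitization ℂ A)) = α := by simp
  rw [h0] at hj1
  exact (((hj1.trans hj2).trans hj3).trans hj4).trans hj5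

lemma CoveringDimLE.exists_fin_refinement {X : Type*} [MetricSpace X] [CompactSpace X]
    (hX : CoveringDimLE X 1) {E : Type*} [NormedAddCommGroup E] (F : C(X, E)) {δ : ℝ}
    (hδ : 0 < δ) :
    ∃ (n : ℕ) (V : Fin n → Set X), (∀ i, IsOpen (V i)) ∧ (∀ x, ∃ i, x ∈ V i) ∧
      (∀ i, ∃ e : E, ∀ y ∈ V i, ‖F y - e‖ < δ) ∧
      ∀ x i j k, i ≠ j → i ≠ k → j ≠ k → x ∈ V i → x ∈ V j → x ∉ V k := by
  classical
  have hop : ∀ x, IsOpen {y | ‖F y - F x‖ < δ} := fun x ↦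
    isOpen_lt (by fun_prop) continuous_const
  obtain ⟨t, -, ht⟩ := isCompact_univ.elim_nhds_subcover (fun x : X ↦ {y | ‖F y - F x‖ < δ})
    fun x _ ↦ (hop x).mem_nhds (by simpa using hδ)
  obtain ⟨W, hW, hWc, hWr, hWn⟩ := hX (t.image fun x ↦ {y | ‖F y - F x‖ < δ})
    (by
      intro U hU
      obtain ⟨x, -, rfl⟩ := Finset.mem_image.mp hU
      exact hop x)
    (by
      refine Set.eq_univ_of_forall fun x ↦ ?_
      obtain ⟨y, hy, hxy⟩ := Set.mem_iUnion₂.mp (ht (Set.mem_univ x))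
      exact ⟨_, Finset.mem_coe.mpr (Finset.mem_image_of_mem _ hy), hxy⟩)
  let e := W.equivFin
  refine ⟨W.card, fun i ↦ (e.symm i : Set X), fun i ↦ hW _ (e.symm i).2, fun x ↦ ?_, fun i ↦ ?_,
    fun x i j k hij hik hjk hi hj hk ↦ ?_⟩
  · obtain ⟨V, hV, hx⟩ := (hWc ▸ Set.mem_univ x : x ∈ ⋃₀ (W : Set (Set X)))
    exact ⟨e ⟨V, hV⟩, by simpa using hx⟩
  · obtain ⟨U, hU, hVU⟩ := hWr _ (e.symm i).2
    obtain ⟨x, -, rfl⟩ := Finset.mem_image.mp hU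
    exact ⟨F x, fun y hy ↦ hVU hy⟩
  · have hinj : ∀ {i j}, i ≠ j → (e.symm i : Set X) ≠ e.symm j := fun h h' ↦
      h (e.symm.injective (Subtype.ext h'))
    have h3 : ({(e.symm i : Set X), (e.symm j : Set X), (e.symm k : Set X)} : Finset (Set X)).card
        = 3 := Finset.card_eq_three.mpr ⟨_, _, _, hinj hij, hinj hik, hinj hjk, rfl⟩
    have hsub : (({(e.symm i : Set X), (e.symm j : Set X), (e.symm k : Set X)} :
        Finset (Set X)) : Set (Set X)) ⊆ {V | V ∈ W ∧ x ∈ V} := by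
      intro V hV
      simp only [Finset.coe_insert, Finset.coe_singleton, Set.mem_insert_iff,
        Set.mem_singleton_iff] at hV
      rcases hV with rfl | rfl | rfl
      exacts [⟨(e.symm i).2, hi⟩, ⟨(e.symm j).2, hj⟩, ⟨(e.symm k).2, hk⟩]
    have := Set.ncard_le_ncard hsub (W.finite_toSet.subset fun V hV ↦ hV.1)
    rw [Set.ncard_coe_finset, h3] at this
    have := hWn x
    omega

lemma JoinedIn.exists_continuous_real {E : Type*} [NormedAddCommGroup E] [NormedSpace ℝ E]
    {S : Set E} {a b : E} (h : JoinedIn S a b) :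
    ∃ L : ℝ → E, Continuous L ∧ L 0 = 0 ∧ L 1 = 0 ∧
      ∀ s t : ℝ, 0 ≤ s → 0 ≤ t → s + t = 1 → s • a + t • b + L t ∈ S := by
  obtain ⟨γ, hγ⟩ := h
  refine ⟨fun t ↦ γ.extend t - ((1 - t) • a + t • b),
    γ.continuous_extend.sub (by fun_prop), by simp, by simp, fun s t hs ht hst ↦ ?_⟩
  obtain rfl : s = 1 - t := by linarith
  rw [add_sub_cancel, γ.extend_apply ⟨ht, by linarith⟩]
  exact hγ _

theorem CoveringDimLE.exists_continuousMap_mem {X : Type*} [MetricSpace X] [CompactSpace X]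
    (hX : CoveringDimLE X 1) {E : Type*} [NormedAddCommGroup E] [NormedSpace ℝ E] {O₀ O₁ : Set E}
    (hd : Dense O₀) (hsub : O₀ ⊆ O₁)
    (hj : ∀ η > 0, ∃ ε > 0, ∀ a ∈ O₀, ∀ a' ∈ O₀, ‖a' - a‖ < ε →
      JoinedIn {c | c ∈ O₁ ∧ ‖c - a‖ < η} a a')
    (F : C(X, E)) {η : ℝ} (hη : 0 < η) :
    ∃ G : C(X, E), ∀ x, G x ∈ O₁ ∧ ‖G x - F x‖ < η := by
  classical
  obtain ⟨ε, hε, hj⟩ := hj (η / 2) (by positivity)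
  obtain ⟨δ, hδ, hδε, hδη⟩ : ∃ δ > 0, 4 * δ ≤ ε ∧ 4 * δ ≤ η :=
    ⟨min ε η / 4, by positivity, by linarith [min_le_left ε η], by linarith [min_le_right ε η]⟩
  obtain ⟨n, V, hV, hVc, hVe, hV3⟩ := hX.exists_fin_refinement F hδ
  choose e he using hVe
  have ha (i : Fin n) : ∃ a ∈ O₀, ‖e i - a‖ < δ := by
    simpa [dist_eq_norm] using hd.exists_dist_lt (e i) hδ
  choose a haO hae using ha
  have haF (i x) (hx : x ∈ V i) : ‖a i - F x‖ < 2 * δ := by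
    have h1 : a i - F x = -((F x - e i) + (e i - a i)) := by abel
    rw [h1, norm_neg]
    linarith [norm_add_le (F x - e i) (e i - a i), he i x hx, hae i]
  obtain ⟨φ, hφ0, hφ1, hφV⟩ := exists_finite_partitionOfUnity V hV hVc
  have hφ3 (x i j) (hij : i ≠ j) (hi : φ i x ≠ 0) (hj : φ j x ≠ 0) (k) (hk : k ≠ i ∧ k ≠ j) :
      φ k x = 0 := by
    by_contra h
    exact hV3 x i j k hij hk.1.symm hk.2.symm (hφV _ _ hi) (hφV _ _ hj) (hφV _ _ h)
  have hφ2 (x i j) (hij : i ≠ j) (hi : φ i x ≠ 0) (hj : φ j x ≠ 0) : φ i x + φ j x = 1 := by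
    rw [← hφ1 x]
    exact (Fintype.sum_eq_add i j hij (hφ3 x i j hij hi hj)).symm
  have hL (p : Fin n × Fin n) : ∃ L : ℝ → E, Continuous L ∧ L 0 = 0 ∧ L 1 = 0 ∧
      ((V p.1 ∩ V p.2).Nonempty → ∀ s t : ℝ, 0 ≤ s → 0 ≤ t → s + t = 1 →
        s • a p.1 + t • a p.2 + L t ∈ {c | c ∈ O₁ ∧ ‖c - a p.1‖ < η / 2}) := by
    by_cases h : (V p.1 ∩ V p.2).Nonempty
    · obtain ⟨x, hx1, hx2⟩ := h
      have h1 : a p.2 - a p.1 = (a p.2 - F x) - (a p.1 - F x) := by abel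
      obtain ⟨L, h1, h2, h3, h4⟩ := (hj _ (haO p.1) _ (haO p.2) (by
        rw [h1]
        linarith [norm_sub_le (a p.2 - F x) (a p.1 - F x), haF _ x hx1, haF _ x hx2])
        ).exists_continuous_real
      exact ⟨L, h1, h2, h3, fun _ ↦ h4⟩
    · exact ⟨0, continuous_const, rfl, rfl, fun h' ↦ absurd h' h⟩
  choose L hLc hL0 hL1 hLP using hL
  let m (p : Fin n × Fin n) (x : X) : E :=
    if p.1 < p.2 ∧ φ p.1 x ≠ 0 ∧ φ p.2 x ≠ 0 then L p (φ p.2 x) else 0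
  have hm (p) : Continuous (m p) := by
    by_cases hp : p.1 < p.2
    swap
    · have : m p = fun _ ↦ 0 := by ext x; simp [m, hp]
      rw [this]; exact continuous_const
    have h1 : ContinuousOn (m p) {x | φ p.1 x + φ p.2 x = 1} := by
      refine ((hLc p).comp (φ p.2).continuous).continuousOn.congr fun x hx ↦ ?_
      by_cases h1 : φ p.1 x = 0
      · have h2 : φ p.2 x = 1 := by simpa [h1] using hx
        simp [m, h1, h2, hL1]
      · by_cases h2 : φ p.2 x = 0
        · simp [m, h2, hL0]
        · simp [m, h1, h2, hp]
    have h2 : ContinuousOn (m p) {x | φ p.1 x * φ p.2 x = 0} := by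
      refine (continuousOn_const (c := (0 : E))).congr fun x hx ↦ ?_
      rcases mul_eq_zero.mp hx with h | h <;> simp [m, h]
    rw [← continuousOn_univ]
    refine (h1.union_of_isClosed h2 (isClosed_eq (by fun_prop) continuous_const)
      (isClosed_eq (by fun_prop) continuous_const)).mono fun x _ ↦ ?_
    by_cases h : φ p.1 x * φ p.2 x = 0
    · exact Or.inr h
    · rw [mul_eq_zero, not_or] at h
      exact Or.inl (hφ2 x _ _ hp.ne h.1 h.2)
  have hpair (x i j) (hij : i < j) (hi : φ i x ≠ 0) (hj : φ j x ≠ 0) :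
      ∑ k, φ k x • a k + ∑ p, m p x ∈ O₁ ∧ ‖∑ k, φ k x • a k + ∑ p, m p x - F x‖ < η := by
    rw [Fintype.sum_eq_add i j hij.ne fun k hk ↦ by rw [hφ3 x i j hij.ne hi hj k hk, zero_smul],
      Fintype.sum_eq_single (i, j)]
    · have h := hLP (i, j) ⟨x, hφV _ _ hi, hφV _ _ hj⟩ _ _ (hφ0 i x) (hφ0 j x)
        (hφ2 x i j hij.ne hi hj)
      have hmx : m (i, j) x = L (i, j) (φ j x) := if_pos ⟨hij, hi, hj⟩
      rw [hmx]
      refine ⟨h.1, ?_⟩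
      have h2 := h.2
      dsimp only at h2
      have h3 := norm_add_le (φ i x • a i + φ j x • a j + L (i, j) (φ j x) - a i) (a i - F x)
      rw [sub_add_sub_cancel] at h3
      linarith [haF i x (hφV _ _ hi)]
    · rintro ⟨k, l⟩ hkl
      refine if_neg ?_
      rintro ⟨hlt, hk, hl⟩
      dsimp only at hlt hk hl
      have hk' : k = i ∨ k = j := by
        by_contra! h; exact hk (hφ3 x i j hij.ne hi hj k h)
      have hl' : l = i ∨ l = j := by
        by_contra! h; exact hl (hφ3 x i j hij.ne hi hj l h)
      rcases hk' with rfl | rfl <;> rcases hl' with rfl | rfl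
      · exact lt_irrefl _ hlt
      · exact hkl rfl
      · exact lt_asymm hij hlt
      · exact lt_irrefl _ hlt
  refine ⟨⟨fun x ↦ ∑ k, φ k x • a k + ∑ p, m p x, ?_⟩, fun x ↦ ?_⟩
  · exact (continuous_finsetSum _ fun k _ ↦ by fun_prop).add
      (continuous_finsetSum _ fun p _ ↦ hm p)
  change ∑ k, φ k x • a k + ∑ p, m p x ∈ O₁ ∧ ‖∑ k, φ k x • a k + ∑ p, m p x - F x‖ < η
  obtain ⟨i, hi⟩ : ∃ i, φ i x ≠ 0 := by
    by_contra! h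
    simpa [h] using hφ1 x
  by_cases h : ∃ j, j ≠ i ∧ φ j x ≠ 0
  · obtain ⟨j, hji, hj'⟩ := h
    rcases lt_or_gt_of_ne hji with h | h
    · exact hpair x j i h hj' hi
    · exact hpair x i j h hi hj'
  · push Not at h
    have h1 : φ i x = 1 := by
      rw [← hφ1 x]
      exact (Fintype.sum_eq_single i h).symm
    have hm0 : ∑ p, m p x = 0 := by
      refine Finset.sum_eq_zero fun p _ ↦ if_neg ?_
      rintro ⟨hlt, hk, hl⟩
      have h2 : p.1 = i := by by_contra h2; exact hk (h _ h2)
      have h3 : p.2 = i := by by_contra h3; exact hl (h _ h3)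
      rw [h2, h3] at hlt
      exact lt_irrefl _ hlt
    rw [hm0, add_zero, Fintype.sum_eq_single i fun k hk ↦ by rw [h k hk, zero_smul], h1, one_smul]
    exact ⟨hsub (haO i), by linarith [haF i x (hφV _ _ hi)]⟩

section

variable {A : Type*} [NonUnitalCStarAlgebra A]

lemma Unitization.continuous_one_add_inr :
    Continuous fun a : A ↦ 1 + (a : Unitization ℂ A) :=
  continuous_const.add Unitization.continuous_inr

lemma Unitization.dense_fst_ne_zero : Dense {x : Unitization ℂ A | x.fst ≠ 0} := by
  intro x
  by_cases hx : x.fst = 0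
  · have hc : Continuous fun t : ℂ ↦ x + algebraMap ℂ (Unitization ℂ A) t := by fun_prop
    have h0 : (0 : ℂ) ∈ closure ({0}ᶜ : Set ℂ) := dense_compl_singleton 0 0
    have := map_mem_closure hc h0 (t := {x : Unitization ℂ A | x.fst ≠ 0}) fun t ht ↦ by
      simpa [hx, Unitization.algebraMap_eq_inl] using ht
    simpa using this
  · exact subset_closure hx

lemma ContinuousMap.isUnit_one_add_inr {X : Type*} [TopologicalSpace X] [CompactSpace X]
    (f : C(X, A)) (hf : ∀ x, IsUnit (1 + (f x : Unitization ℂ A))) :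
    IsUnit (1 + (f : Unitization ℂ C(X, A))) := by
  have hz (x : X) : ∃ z : A, f x + z + f x * z = 0 ∧ f x + z + z * f x = 0 ∧
      (Ring.inverse (1 + (f x : Unitization ℂ A))).snd = z := by
    obtain ⟨z, h1, h2⟩ := Unitization.isUnit_one_add_inr_iff.mp (hf x)
    refine ⟨z, h1, h2, ?_⟩
    have h3 : (1 + (f x : Unitization ℂ A)) * (1 + (z : Unitization ℂ A)) = 1 := by
      ext
      · simp
      · simpa [add_comm, add_left_comm] using h1
    rw [left_inv_eq_right_inv (Ring.inverse_mul_cancel _ (hf x)) h3]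
    simp
  have hc : Continuous fun x ↦ (Ring.inverse (1 + (f x : Unitization ℂ A))).snd := by
    refine Unitization.continuous_snd.comp (continuous_iff_continuousAt.mpr fun x ↦ ?_)
    obtain ⟨u, hu⟩ := hf x
    have h1 := NormedRing.inverse_continuousAt u
    rw [hu] at h1
    exact ContinuousAt.comp (f := fun x ↦ 1 + (f x : Unitization ℂ A)) h1
      (Unitization.continuous_one_add_inr.comp f.continuous).continuousAt
  refine Unitization.isUnit_one_add_inr_iff.mpr ⟨⟨_, hc⟩, ?_, ?_⟩ <;> ext x <;>
    obtain ⟨z, h1, h2, h3⟩ := hz x <;> simpa [h3]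

lemma Unitization.inr_half_sum_star_mul_self (a b : A) :
    1 + (((1 / 2 : ℂ) • (star a + a + star a * a + (star b + b + star b * b)) : A) :
      Unitization ℂ A) =
      (1 / 2 : ℂ) • (star (1 + (a : Unitization ℂ A)) * (1 + (a : Unitization ℂ A)) +
        star (1 + (b : Unitization ℂ A)) * (1 + (b : Unitization ℂ A))) := by
  ext
  · simp; norm_num
  · simp; abel

lemma CStarAlgebra.isUnit_sum_star_mul_self {E : Type*} [CStarAlgebra E] {a b : E}
    (h : IsUnit a ∨ IsUnit b) : IsUnit (star a * a + star b * b) := by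
  let _ := CStarAlgebra.spectralOrder E
  have := CStarAlgebra.spectralOrderedRing E
  rcases h with h | h
  · exact CStarAlgebra.isUnit_of_le (star a * a) (le_add_of_nonneg_right (star_mul_self_nonneg b))
      ((h.star.mul h).isStrictlyPositive (star_mul_self_nonneg a))
  · exact CStarAlgebra.isUnit_of_le (star b * b) (le_add_of_nonneg_left (star_mul_self_nonneg a))
      ((h.star.mul h).isStrictlyPositive (star_mul_self_nonneg b))

lemma IsUnit.complex_smul {E : Type*} [Ring E] [Algebra ℂ E] {x : E} (hx : IsUnit x) {c : ℂ}
    (hc : c ≠ 0) : IsUnit (c • x) := by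
  rw [← Units.val_mk0 hc]
  exact hx.smul (Units.mk0 _ hc)

lemma ContinuousMap.exists_mul_add_mul_eq_one {X : Type*} [TopologicalSpace X] [CompactSpace X]
    (f g : C(X, A))
    (h : ∀ x, IsUnit (1 + (f x : Unitization ℂ A)) ∨ IsUnit (1 + (g x : Unitization ℂ A))) :
    ∃ b c : Unitization ℂ C(X, A),
      b * (1 + (f : Unitization ℂ C(X, A))) + c * (1 + (g : Unitization ℂ C(X, A))) = 1 := by
  have hu := ContinuousMap.isUnit_one_add_inr
    ((1 / 2 : ℂ) • (star f + f + star f * f + (star g + g + star g * g))) fun x ↦ by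
      have := Unitization.inr_half_sum_star_mul_self (f x) (g x)
      have h1 := (CStarAlgebra.isUnit_sum_star_mul_self (h x)).complex_smul
        (by norm_num : (1 / 2 : ℂ) ≠ 0)
      rw [← this] at h1
      exact h1
  rw [Unitization.inr_half_sum_star_mul_self] at hu
  obtain ⟨v, -, hv⟩ := isUnit_iff_exists.mp hu
  refine ⟨v * ((1 / 2 : ℂ) • star (1 + (f : Unitization ℂ C(X, A)))),
    v * ((1 / 2 : ℂ) • star (1 + (g : Unitization ℂ C(X, A)))), ?_⟩
  refine Eq.trans ?_ hv
  rw [mul_assoc, mul_assoc, ← mul_add, smul_mul_assoc, smul_mul_assoc, ← smul_add]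

lemma stableRankLE_two_of_dense {D : Type*} [NonUnitalCStarAlgebra D]
    (h : Dense {p : D × D | ∃ b c : Unitization ℂ D,
      b * (1 + (p.1 : Unitization ℂ D)) + c * (1 + (p.2 : Unitization ℂ D)) = 1}) :
    StableRankLE D 2 := by
  have hP : Dense (Set.univ.pi fun _ : Fin 2 ↦ {x : Unitization ℂ D | x.fst ≠ 0}) :=
    dense_pi _ fun _ _ ↦ Unitization.dense_fst_ne_zero
  refine dense_closure.mp (hP.mono fun a ha ↦ ?_)
  have h0 : (a 0).fst ≠ 0 := ha 0 trivial
  have h1 : (a 1).fst ≠ 0 := ha 1 trivial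
  have hinr : Continuous fun a : D ↦ (a : Unitization ℂ D) := Unitization.continuous_inr
  have hψ : Continuous fun p : D × D ↦ (![(a 0).fst • (1 + (p.1 : Unitization ℂ D)),
      (a 1).fst • (1 + (p.2 : Unitization ℂ D))] : Fin 2 → Unitization ℂ D) := by
    refine continuous_pi fun i ↦ ?_
    fin_cases i <;> simp <;> fun_prop
  have hmem := map_mem_closure hψ (h ((a 0).fst⁻¹ • (a 0).snd, (a 1).fst⁻¹ • (a 1).snd))
    (t := {a : Fin 2 → Unitization ℂ D | ∃ b : Fin 2 → Unitization ℂ D, ∑ i, b i * a i = 1})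
    (by
      rintro ⟨p, q⟩ ⟨b, c, hbc⟩
      refine ⟨![(a 0).fst⁻¹ • b, (a 1).fst⁻¹ • c], ?_⟩
      rw [Fin.sum_univ_two]
      change ((a 0).fst⁻¹ • b) * ((a 0).fst • (1 + (p : Unitization ℂ D))) +
        ((a 1).fst⁻¹ • c) * ((a 1).fst • (1 + (q : Unitization ℂ D))) = 1
      rwa [smul_mul_smul_comm, smul_mul_smul_comm, inv_mul_cancel₀ h0, inv_mul_cancel₀ h1,
        one_smul, one_smul])
  convert hmem using 1
  ext i <;> fin_cases i <;> simp [h0, h1]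

lemma StableRankOne.stableRankLE_one (h : StableRankOne A) : StableRankLE A 1 := by
  have h1 := Dense.preimage h (Homeomorph.funUnique (Fin 1) (Unitization ℂ A)).isOpenMap
  refine h1.mono fun a ha ↦ ?_
  obtain ⟨b, -, hb⟩ := isUnit_iff_exists.mp (show IsUnit (a 0) from ha)
  exact ⟨fun _ ↦ b, by simpa using hb⟩

lemma StableRankLE.stableRankOne (h : StableRankLE A 1) : StableRankOne A := by
  have hL : Dense {a : Unitization ℂ A | ∃ b, b * a = 1} := by
    have h1 := Dense.preimage h (Homeomorph.funUnique (Fin 1) (Unitization ℂ A)).symm.isOpenMap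
    refine h1.mono fun a ha ↦ ?_
    obtain ⟨b, hb⟩ := ha
    exact ⟨b 0, by simpa using hb⟩
  refine hL.mono ?_
  rintro a ⟨b, hb⟩
  have hc : Continuous fun c : Unitization ℂ A ↦ c * a := by fun_prop
  have hop : IsOpen {c : Unitization ℂ A | IsUnit (c * a)} := Units.isOpen.preimage hc
  obtain ⟨c, hc1, d, hd⟩ := hL.inter_open_nonempty _ hop ⟨b, by simp [hb]⟩
  obtain ⟨v, hv1, hv2⟩ := isUnit_iff_exists.mp (show IsUnit (c * a) from hc1)
  have hcr : c * (a * v) = 1 := by rw [← mul_assoc, hv1]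
  have hcu : IsUnit c := isUnit_iff_exists.mpr ⟨d, by
    have : d = a * v := left_inv_eq_right_inv hd hcr
    rw [this, hcr], hd⟩
  obtain ⟨u, rfl⟩ := hcu
  have : a = ↑u⁻¹ * (↑u * a) := by simp
  rw [this]
  exact (Units.isUnit _).mul hc1

variable {X : Type*} [MetricSpace X] [CompactSpace X]

theorem NoK1Obstructions.stableRankOne_continuousMap (hX : CoveringDimLE X 1)
    (hA : NoK1Obstructions A) : StableRankOne C(X, A) := by
  rw [stableRankOne_iff, Metric.dense_iff]
  intro F η hη
  obtain ⟨G, hG⟩ := hX.exists_continuousMap_mem (stableRankOne_iff.mp hA.1) subset_rfl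
    (fun η hη ↦ by
      obtain ⟨ε, hε, h⟩ := hA.exists_joinedIn hη
      exact ⟨ε, hε, fun a ha a' ha' ↦ h a a' ha ha'⟩) F hη
  refine ⟨G, ?_, ContinuousMap.isUnit_one_add_inr G fun x ↦ (hG x).1⟩
  rw [Metric.mem_ball, ContinuousMap.dist_lt_iff hη]
  intro x
  rw [dist_eq_norm]
  exact (hG x).2

lemma joinedIn_prod_isUnit {η : ℝ} {p q : A × A}
    (hp : IsUnit (1 + (p.1 : Unitization ℂ A)) ∧ IsUnit (1 + (p.2 : Unitization ℂ A)))
    (hq : IsUnit (1 + (q.1 : Unitization ℂ A)) ∧ IsUnit (1 + (q.2 : Unitization ℂ A)))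
    (hpq : ‖q - p‖ < η) :
    JoinedIn {r : A × A | (IsUnit (1 + (r.1 : Unitization ℂ A)) ∨
      IsUnit (1 + (r.2 : Unitization ℂ A))) ∧ ‖r - p‖ < η} p q := by
  have hη : 0 < η := (norm_nonneg _).trans_lt hpq
  have hball : ∀ r : A × A, r ∈ Metric.ball p η ↔ ‖r - p‖ < η := fun r ↦ by
    rw [Metric.mem_ball, dist_eq_norm]
  have hm : (p.1, q.2) ∈ Metric.ball p η := by
    rw [hball, Prod.norm_def]
    refine max_lt (by simpa using hη) ?_
    exact (norm_snd_le (q - p)).trans_lt hpq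
  refine JoinedIn.trans (y := (p.1, q.2)) (JoinedIn.of_segment_subset ?_)
    (JoinedIn.of_segment_subset ?_)
  · refine fun r hr ↦ ⟨Or.inl ?_, (hball r).mp
      ((convex_ball p η).segment_subset (Metric.mem_ball_self hη) hm hr)⟩
    obtain ⟨s, t, -, -, hst, rfl⟩ := hr
    simpa [← add_smul, hst] using hp.1
  · refine fun r hr ↦ ⟨Or.inr ?_, (hball r).mp
      ((convex_ball p η).segment_subset hm ((hball q).mpr hpq) hr)⟩
    obtain ⟨s, t, -, -, hst, rfl⟩ := hr
    simpa [← add_smul, hst] using hq.2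

theorem StableRankOne.stableRankLE_two_continuousMap (hX : CoveringDimLE X 1)
    (hA : StableRankOne A) : StableRankLE C(X, A) 2 := by
  refine stableRankLE_two_of_dense (Metric.dense_iff.mpr ?_)
  rintro ⟨f, g⟩ η hη
  have hd := stableRankOne_iff.mp hA
  have hd2 := hd.prod hd
  obtain ⟨G, hG⟩ := hX.exists_continuousMap_mem (O₁ := {r : A × A |
      IsUnit (1 + (r.1 : Unitization ℂ A)) ∨ IsUnit (1 + (r.2 : Unitization ℂ A))}) hd2
    (fun p hp ↦ Or.inl hp.1)
    (fun η hη ↦ ⟨η, hη, fun p hp q hq hpq ↦ joinedIn_prod_isUnit hp hq hpq⟩) (f.prodMk g) hη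
  refine ⟨(ContinuousMap.fst.comp G, ContinuousMap.snd.comp G), ?_,
    ContinuousMap.exists_mul_add_mul_eq_one _ _ fun x ↦ (hG x).1⟩
  rw [Metric.mem_ball, Prod.dist_eq]
  refine max_lt ?_ ?_ <;> rw [ContinuousMap.dist_lt_iff hη] <;> intro x <;> rw [dist_eq_norm]
  · exact (norm_fst_le (G x - f.prodMk g x)).trans_lt (hG x).2
  · exact (norm_snd_le (G x - f.prodMk g x)).trans_lt (hG x).2

end

lemma IsPreconnected.joinedIn_of_isOpen {M : Type*} [TopologicalSpace M]
    [LocallyPathConnectedSpace M] {S U : Set M} (hS : IsPreconnected S) (hU : IsOpen U)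
    (hSU : S ⊆ U) {a b : M} (ha : a ∈ S) (hb : b ∈ S) : JoinedIn U a b := by
  by_contra hab
  obtain ⟨c, -, hac, hc⟩ := hS (pathComponentIn U a)
    (⋃ y ∈ {y | y ∈ U ∧ ¬ JoinedIn U a y}, pathComponentIn U y) (hU.pathComponentIn a)
    (isOpen_biUnion fun y _ ↦ hU.pathComponentIn y) (by
      intro y hy
      by_cases h : JoinedIn U a y
      · exact Or.inl h
      · exact Or.inr (Set.mem_biUnion (show y ∈ {y | y ∈ U ∧ ¬ JoinedIn U a y} from ⟨hSU hy, h⟩)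
          (JoinedIn.refl (hSU hy))))
    ⟨a, ha, JoinedIn.refl (hSU ha)⟩
    ⟨b, hb, Set.mem_biUnion (show b ∈ {y | y ∈ U ∧ ¬ JoinedIn U a y} from ⟨hSU hb, hab⟩)
      (JoinedIn.refl (hSU hb))⟩
  obtain ⟨y, hy, hyc⟩ := Set.mem_iUnion₂.mp hc
  exact hy.2 (JoinedIn.trans hac (JoinedIn.symm hyc))

attribute [local instance] Matrix.linftyOpNormedRing in
lemma Matrix.isOpen_isUnit {R ι : Type*} [NormedRing R] [CompleteSpace R] [Fintype ι]
    [DecidableEq ι] : IsOpen {M : Matrix ι ι R | IsUnit M} := by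
  have : @CompleteSpace (Matrix ι ι R) PseudoMetricSpace.toUniformSpace :=
    inferInstanceAs (CompleteSpace (ι → ι → R))
  exact Units.isOpen

section

variable {X B : Type*} [TopologicalSpace X] [CompactSpace X] [NonUnitalCStarAlgebra B]

/-- Evaluation at a point, extended to the unitizations. -/
def ContinuousMap.unitizationEval (x : X) : Unitization ℂ C(X, B) →⋆ₐ[ℂ] Unitization ℂ B :=
  Unitization.starMap
    { toFun := fun f ↦ f x
      map_smul' := fun _ _ ↦ rfl
      map_zero' := rfl
      map_add' := fun _ _ ↦ rfl
      map_mul' := fun _ _ ↦ rfl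
      map_star' := fun _ ↦ rfl }

lemma ContinuousMap.unitizationEval_apply (x : X) (g : Unitization ℂ C(X, B)) :
    unitizationEval x g = Unitization.inl g.fst + ((g.snd x : B) : Unitization ℂ B) := rfl

lemma ContinuousMap.continuous_unitizationEval (x : X) :
    Continuous (unitizationEval x : Unitization ℂ C(X, B) → Unitization ℂ B) := by
  have h1 : Continuous fun g : Unitization ℂ C(X, B) ↦ g.snd x :=
    (continuous_eval_const x).comp Unitization.continuous_snd
  exact ((continuous_algebraMap ℂ (Unitization ℂ B)).comp Unitization.continuous_fst).add
    (Unitization.continuous_inr.comp h1)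

lemma ContinuousMap.continuous_unitizationEval_apply (g : Unitization ℂ C(X, B)) :
    Continuous fun x ↦ unitizationEval x g :=
  continuous_const.add (Unitization.continuous_inr.comp g.snd.continuous)

end

lemma StableRankOne.joinedIn_of_continuousMap {X B : Type*} [MetricSpace X] [CompactSpace X]
    [NonUnitalCStarAlgebra B] (hB : StableRankOne C(X, B)) {t : Set X} (ht : IsPreconnected t)
    {p q : X} (hp : p ∈ t) (hq : q ∈ t) (hpq : p ≠ q) {ι : Type*} [Fintype ι] [DecidableEq ι]
    {v : Matrix ι ι (Unitization ℂ B)} (hv : IsUnit v)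
    (hfst : ∀ i j, (v i j).fst = (1 : Matrix ι ι ℂ) i j) :
    JoinedIn {M : Matrix ι ι (Unitization ℂ B) | IsUnit M} 1 v := by
  have : LocallyPathConnectedSpace (Unitization ℂ B) := inferInstance
  have : LocallyPathConnectedSpace (Matrix ι ι (Unitization ℂ B)) :=
    inferInstanceAs (LocallyPathConnectedSpace (ι → ι → Unitization ℂ B))
  have hop : IsOpen {M : Matrix ι ι (Unitization ℂ B) | IsUnit M} := Matrix.isOpen_isUnit
  let Ψ (x : X) (g : Matrix ι ι (Unitization ℂ C(X, B))) : Matrix ι ι (Unitization ℂ B) :=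
    g.map (ContinuousMap.unitizationEval x)
  have hΨ (x) : Continuous (Ψ x) :=
    continuous_id.matrix_map (ContinuousMap.continuous_unitizationEval x)
  have hΨu (x g) (hg : IsUnit g) : IsUnit (Ψ x g) :=
    hg.map (ContinuousMap.unitizationEval (B := B) x).toAlgHom.toRingHom.mapMatrix
  let f : Matrix ι ι (Unitization ℂ C(X, B)) := Matrix.of fun i j ↦
    Unitization.inl ((1 : Matrix ι ι ℂ) i j) +
      ((⟨fun x ↦ (dist x p / dist q p) • (v i j).snd, by fun_prop⟩ : C(X, B)) :
        Unitization ℂ C(X, B))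
  have hdist : dist q p ≠ 0 := dist_ne_zero.mpr hpq.symm
  have hfp : Ψ p f = 1 := by
    ext i j
    · by_cases h : i = j <;> simp [Ψ, f, ContinuousMap.unitizationEval_apply, Matrix.one_apply, h]
    · by_cases h : i = j <;> simp [Ψ, f, ContinuousMap.unitizationEval_apply, Matrix.one_apply, h]
  have hfq : Ψ q f = v := by
    ext i j
    · simp [Ψ, f, ContinuousMap.unitizationEval_apply, hfst]
    · simp [Ψ, f, ContinuousMap.unitizationEval_apply, hdist]
  have hdense := Matrix.dense_isUnit hB ι
  obtain ⟨g, ⟨hg1, hg2⟩, hg⟩ := hdense.inter_open_nonempty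
    (Ψ p ⁻¹' pathComponentIn {M | IsUnit M} 1 ∩ Ψ q ⁻¹' pathComponentIn {M | IsUnit M} v)
    (((hop.pathComponentIn 1).preimage (hΨ p)).inter ((hop.pathComponentIn v).preimage (hΨ q)))
    ⟨f, by simpa [hfp, pathComponentIn] using JoinedIn.refl (show (1 : Matrix ι ι
        (Unitization ℂ B)) ∈ {M | IsUnit M} from isUnit_one),
      by simpa [hfq, pathComponentIn] using JoinedIn.refl (show v ∈ {M | IsUnit M} from hv)⟩
  have hc : Continuous fun x ↦ Ψ x g := continuous_pi fun i ↦ continuous_pi fun j ↦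
    ContinuousMap.continuous_unitizationEval_apply (g i j)
  have hmid : JoinedIn {M : Matrix ι ι (Unitization ℂ B) | IsUnit M} (Ψ p g) (Ψ q g) :=
    (ht.image _ hc.continuousOn).joinedIn_of_isOpen hop
      (by rintro _ ⟨x, -, rfl⟩; exact hΨu x g hg) ⟨p, hp, rfl⟩ ⟨q, hq, rfl⟩
  exact (JoinedIn.trans hg1 hmid).trans (JoinedIn.symm hg2)

open Polynomial in
lemma Matrix.joinedIn_isUnit_complex {ι : Type*} [Fintype ι] [DecidableEq ι] {u : Matrix ι ι ℂ}
    (hu : IsUnit u) : JoinedIn {M : Matrix ι ι ℂ | IsUnit M} 1 u := by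
  let P : ℂ[X] := ((1 : Matrix ι ι ℂ[X]) + (X : ℂ[X]) • (u - 1).map C).det
  have hP (z : ℂ) : P.eval z = (1 + z • (u - 1)).det := by
    rw [← coe_evalRingHom, RingHom.map_det]
    congr 1
    ext i j
    by_cases hij : i = j
    · simp [hij]
    · simp [hij]
      ring
  have hP0 : P ≠ 0 := by
    intro h
    have := hP 0
    simp [h] at this
  have hcount : {z : ℂ | P.IsRoot z}.Countable := (P.finite_setOfPred_isRoot hP0).countable
  have hj := (hcount.isPathConnected_compl_of_one_lt_rank (by simp)).joinedIn 0
    (by simp [hP]) 1 (by simpa [hP] using ((Matrix.isUnit_iff_isUnit_det u).mp hu).ne_zero)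
  have h2 := hj.map (f := fun z : ℂ ↦ 1 + z • (u - 1)) (by fun_prop)
  simp only [zero_smul, add_zero, one_smul, add_sub_cancel] at h2
  refine h2.mono ?_
  rintro _ ⟨z, hz, rfl⟩
  refine (Matrix.isUnit_iff_isUnit_det _).mpr (isUnit_iff_ne_zero.mpr ?_)
  simpa [hP] using hz

lemma K1Trivial.of_joinedIn_isUnit {B : Type*} [NonUnitalCStarAlgebra B]
    (h : ∀ (n : ℕ) (v : Matrix (Fin n) (Fin n) (Unitization ℂ B)), IsUnit v →
      (∀ i j, (v i j).fst = (1 : Matrix (Fin n) (Fin n) ℂ) i j) →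
      JoinedIn {M : Matrix (Fin n) (Fin n) (Unitization ℂ B) | IsUnit M} 1 v) :
    K1Trivial B := by
  intro n _ u
  have hu : IsUnit u.1 := (Unitary.toUnits u).isUnit
  have hjoin : JoinedIn {M : Matrix (Fin n) (Fin n) (Unitization ℂ B) | IsUnit M} 1 u.1 := by
    let ρ : Matrix (Fin n) (Fin n) (Unitization ℂ B) →+* Matrix (Fin n) (Fin n) ℂ :=
      (Unitization.fstHom ℂ B).toRingHom.mapMatrix
    let σ : Matrix (Fin n) (Fin n) ℂ →+* Matrix (Fin n) (Fin n) (Unitization ℂ B) :=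
      (algebraMap ℂ (Unitization ℂ B)).mapMatrix
    have hσc : Continuous σ :=
      continuous_id.matrix_map (algebraMap ℂ (Unitization ℂ B) |> fun _ ↦ by fun_prop)
    have hρσ (M) : ρ (σ M) = M := by
      ext i j
      simp [ρ, σ, Unitization.algebraMap_eq_inl]
    have hsu : IsUnit (ρ u.1) := hu.map ρ
    obtain ⟨w, hw1, hw2⟩ := isUnit_iff_exists.mp hsu
    have hw : IsUnit w := isUnit_iff_exists.mpr ⟨_, hw2, hw1⟩
    have h1 : JoinedIn {M : Matrix (Fin n) (Fin n) (Unitization ℂ B) | IsUnit M} 1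
        (σ (ρ u.1)) := by
      have := (Matrix.joinedIn_isUnit_complex hsu).map hσc
      rw [map_one] at this
      refine this.mono ?_
      rintro _ ⟨M, hM, rfl⟩
      exact hM.map σ
    have h2 := h n (σ w * u.1) ((hw.map σ).mul hu) fun i j ↦ by
      have : ρ (σ w * u.1) = 1 := by rw [map_mul, hρσ, hw2]
      rw [← this]
      rfl
    have h3 := h2.map (f := fun M ↦ σ (ρ u.1) * M) (by fun_prop)
    rw [mul_one, ← mul_assoc, ← map_mul, hw1, map_one, one_mul] at h3
    refine h1.trans (h3.mono ?_)
    rintro _ ⟨M, hM, rfl⟩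
    exact (hsu.map σ).mul hM
  have hunit : JoinedIn (unitary (Matrix (Fin n) (Fin n) (Unitization ℂ B)) : Set _) 1 u.1 := by
    obtain ⟨U, hUc, hU, hUfix, -⟩ :=
      CStarAlgebra.exists_unitary_retraction (CStarMatrix (Fin n) (Fin n) (Unitization ℂ B))
    have h1 : JoinedIn {M : CStarMatrix (Fin n) (Fin n) (Unitization ℂ B) | IsUnit M} 1 u.1 := hjoin
    have h2 := h1.map_continuousOn hUc
    rw [hUfix 1 (one_mem _), hUfix u.1 u.2] at h2
    have h3 : @JoinedIn (CStarMatrix (Fin n) (Fin n) (Unitization ℂ B)) _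
        (unitary (CStarMatrix (Fin n) (Fin n) (Unitization ℂ B))) 1 u.1 := by
      refine h2.mono ?_
      rintro _ ⟨M, hM, rfl⟩
      exact hU M hM
    exact h3
  have hbl (M : Matrix (Fin n) (Fin n) (Unitization ℂ B)) (hM : M ∈ unitary (Matrix (Fin n) (Fin n)
      (Unitization ℂ B))) : Matrix.fromBlocks M 0 0 (1 : Matrix (Fin 0) (Fin 0) (Unitization ℂ B)) ∈
      unitary (Matrix (Fin n ⊕ Fin 0) (Fin n ⊕ Fin 0) (Unitization ℂ B)) := by
    rw [Unitary.mem_iff, Matrix.star_eq_conjTranspose] at hM ⊢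
    simp [Matrix.fromBlocks_conjTranspose, Matrix.fromBlocks_multiply, hM.1, hM.2]
  refine ⟨0, hbl _ u.2, ?_⟩
  have h3 := hunit.joined_subtype
  have h4 := h3.map (f := fun M : unitary (Matrix (Fin n) (Fin n) (Unitization ℂ B)) ↦
    (⟨_, hbl M.1 M.2⟩ : unitary (Matrix (Fin n ⊕ Fin 0) (Fin n ⊕ Fin 0) (Unitization ℂ B))))
    (Continuous.subtype_mk (Continuous.matrix_fromBlocks continuous_subtype_val continuous_const
      continuous_const continuous_const) _)
  convert h4 using 1
  exact Subtype.ext Matrix.fromBlocks_one.symm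

lemma coveringDimLE_zero_of_totallyDisconnected {X : Type*} [TopologicalSpace X] [CompactSpace X]
    [T2Space X] [TotallyDisconnectedSpace X] : CoveringDimLE X 0 := by
  classical
  intro W hW hc
  have h1 (x : X) : ∃ U ∈ W, ∃ D : Set X, IsClopen D ∧ x ∈ D ∧ D ⊆ U := by
    obtain ⟨U, hU, hx⟩ := (hc ▸ Set.mem_univ x : x ∈ ⋃₀ (W : Set (Set X)))
    obtain ⟨D, hD⟩ := compact_exists_isClopen_in_isOpen (hW U hU) hx
    exact ⟨U, hU, D, hD⟩
  choose U hUW D hD hxD hDU using h1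
  obtain ⟨t, -, ht⟩ := isCompact_univ.elim_nhds_subcover D fun x _ ↦ (hD x).2.mem_nhds (hxD x)
  obtain ⟨C, hC, -, hCD, hDC, hdisj⟩ := exists_clopen_partition_of_clopen_cover
    (I := t) (Z := fun _ ↦ ∅) (D := fun i ↦ D i) (fun _ ↦ isClosed_empty) (fun i ↦ hD i)
    (fun _ ↦ Set.empty_subset _) (fun _ _ _ _ _ ↦ by simp)
  refine ⟨Finset.univ.image C, fun V hV ↦ ?_, Set.eq_univ_of_forall fun x ↦ ?_, fun V hV ↦ ?_,
    fun x ↦ ?_⟩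
  · obtain ⟨i, -, rfl⟩ := Finset.mem_image.mp hV
    exact (hC i).2
  · obtain ⟨y, hy, hxy⟩ := Set.mem_iUnion₂.mp (ht (Set.mem_univ x))
    obtain ⟨i, hi⟩ := Set.mem_iUnion.mp (hDC (Set.mem_iUnion.mpr ⟨⟨y, hy⟩, hxy⟩))
    exact ⟨C i, by simp, hi⟩
  · obtain ⟨i, -, rfl⟩ := Finset.mem_image.mp hV
    exact ⟨U i, hUW i, (hCD i).trans (hDU i)⟩
  · rw [zero_add, Set.ncard_le_one ((Finset.univ.image C).finite_toSet.subset fun V hV ↦ hV.1)]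
    rintro V ⟨hV, hxV⟩ V' ⟨hV', hxV'⟩
    obtain ⟨i, -, rfl⟩ := Finset.mem_image.mp hV
    obtain ⟨j, -, rfl⟩ := Finset.mem_image.mp hV'
    by_contra hij
    exact Set.disjoint_left.mp (hdisj (Set.mem_univ i) (Set.mem_univ j)
      fun h ↦ hij (congrArg C h)) hxV hxV'

lemma CoveringDimEq.exists_isPreconnected {X : Type*} [MetricSpace X] [CompactSpace X]
    (hX : CoveringDimEq X 1) :
    ∃ t : Set X, IsPreconnected t ∧ ∃ p ∈ t, ∃ q ∈ t, p ≠ q := by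
  by_contra! h
  have : TotallyDisconnectedSpace X := ⟨fun t _ ht p hp q hq ↦ h t ht p hp q hq⟩
  exact absurd (hX.2 0 coveringDimLE_zero_of_totallyDisconnected) (by norm_num)

theorem NoK1Obstructions.of_stableRankOne_continuousMap {A X : Type*} [NonUnitalCStarAlgebra A]
    [MetricSpace X] [CompactSpace X] (hA : StableRankOne A) (hX : CoveringDimEq X 1)
    (h : StableRankOne C(X, A)) : NoK1Obstructions A := by
  refine ⟨hA, fun B _ hB ↦ K1Trivial.of_joinedIn_isUnit fun n v hv hfst ↦ ?_⟩
  obtain ⟨t, ht, p, hp, q, hq, hpq⟩ := hX.exists_isPreconnected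
  let φ : C(X, B) →ₙₐ[ℂ] C(X, A) :=
    { toFun := fun f ↦ ⟨fun x ↦ (f x : A), by fun_prop⟩
      map_smul' := fun _ _ ↦ rfl
      map_zero' := rfl
      map_add' := fun _ _ ↦ rfl
      map_mul' := fun _ _ ↦ rfl }
  have hD : StableRankOne C(X, B) := by
    refine StableRankOne.of_hereditary φ (fun f ↦ ?_) (fun f g f' ↦ ?_) h
    · exact le_antisymm
        ((ContinuousMap.norm_le _ (norm_nonneg f)).mpr fun x ↦ f.norm_coe_le_norm x)
        ((ContinuousMap.norm_le _ (norm_nonneg (φ f))).mpr fun x ↦ (φ f).norm_coe_le_norm x)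
    · exact ⟨⟨fun x ↦ ⟨f x * g x * f' x, hB _ (f x).2 _ _ (f' x).2⟩,
        Continuous.subtype_mk (by fun_prop) _⟩, rfl⟩
  exact hD.joinedIn_of_continuousMap ht hp hq hpq hv hfst

theorem stmt6 (A : Type*) [NonUnitalCStarAlgebra A] (hA : StableRankOne A)
    (X : Type*) [MetricSpace X] [CompactSpace X] (hX : CoveringDimEq X 1) :
    (NoK1Obstructions A → stableRank C(X, A) = 1) ∧
    (¬ NoK1Obstructions A → stableRank C(X, A) = 2) := by
  constructor
  · intro h
    refine le_antisymm (Nat.sInf_le ⟨one_pos, (h.stableRankOne_continuousMap hX.1).stableRankLE_one⟩)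
      ?_
    exact le_csInf ⟨1, one_pos, (h.stableRankOne_continuousMap hX.1).stableRankLE_one⟩
      fun n hn ↦ hn.1
  · intro h
    have h2 : StableRankLE C(X, A) 2 := hA.stableRankLE_two_continuousMap hX.1
    refine le_antisymm (Nat.sInf_le ⟨two_pos, h2⟩) (le_csInf ⟨2, two_pos, h2⟩ ?_)
    rintro n ⟨hn, hsr⟩
    by_contra hlt
    obtain rfl : n = 1 := by omega
    exact h (NoK1Obstructions.of_stableRankOne_continuousMap hA hX hsr.stableRankOne)
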